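/- If G is a connected subcubic n-vertex graph that has no induced 6-cycle and is not isomorphic to any of the 12 exceptional graphs (P3, C3, C7, G_{7,1},…,G_{7,6}, C11, G11, G15), then ι(G, P3) ≤ ⌊n/4⌋. -/

import Mathlib

open SimpleGraph

/-- `G` contains a copy of the 3-vertex path as a (not necessarily induced) subgraph. -/
def containsP3 {V : Type*} (G : SimpleGraph V) : Prop :=
  ∃ f : Fin 3 → V, Function.Injective f ∧
    ∀ a b, (SimpleGraph.pathGraph 3).Adj a b → G.Adj (f a) (f b)

/-- The closed neighbourhood `N[D]` of a set of vertices `D`. -/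
def closedNbhd {V : Type*} (G : SimpleGraph V) (D : Set V) : Set V :=
  {v | v ∈ D ∨ ∃ d ∈ D, G.Adj d v}

/-- `D` is a `P3`-isolating set of `G`: `G - N[D]` contains no copy of `P3`. -/
def IsP3Isolating {V : Type*} (G : SimpleGraph V) (D : Set V) : Prop :=
  ¬ containsP3 (G.induce (closedNbhd G D)ᶜ)

/-- The `P3`-isolation number `ι(G, P3)`. -/
noncomputable def iotaP3 {V : Type*} (G : SimpleGraph V) : ℕ :=
  sInf {n | ∃ D : Finset V, D.card = n ∧ IsP3Isolating G ↑D}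

/-- `G` has an induced 6-cycle. -/
def hasInducedC6 {V : Type*} (G : SimpleGraph V) : Prop :=
  ∃ f : Fin 6 → V, Function.Injective f ∧
    ∀ a b, G.Adj (f a) (f b) ↔ (SimpleGraph.cycleGraph 6).Adj a b

/-- The graph `G₇,₁` of the paper, vertices `0,…,6` standing for `1,…,7`. -/
def G71graph : SimpleGraph (Fin 7) :=
  SimpleGraph.fromRel (fun u v => ((u.val, v.val) ∈
    [(0,1),(1,2),(2,3),(2,4),(3,4),(4,5),(5,0),(0,6)] : Prop))

/-- The graph `G₇,₂` of the paper. -/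
def G72graph : SimpleGraph (Fin 7) :=
  SimpleGraph.fromRel (fun u v => ((u.val, v.val) ∈
    [(0,1),(1,2),(2,3),(2,4),(3,4),(4,5),(5,0),(0,6),(1,6)] : Prop))

/-- The graph `G₇,₃` of the paper. -/
def G73graph : SimpleGraph (Fin 7) :=
  SimpleGraph.fromRel (fun u v => ((u.val, v.val) ∈
    [(0,1),(1,2),(2,3),(2,4),(3,4),(4,5),(5,0),(0,6),(3,6)] : Prop))

/-- The graph `G₇,₄` of the paper. -/
def G74graph : SimpleGraph (Fin 7) :=
  SimpleGraph.fromRel (fun u v => ((u.val, v.val) ∈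
    [(0,1),(1,2),(2,3),(2,4),(3,4),(4,5),(5,0),(0,6),(1,6),(3,6)] : Prop))

/-- The graph `G₇,₅` of the paper. -/
def G75graph : SimpleGraph (Fin 7) :=
  SimpleGraph.fromRel (fun u v => ((u.val, v.val) ∈
    [(0,1),(0,6),(1,2),(1,6),(2,3),(2,4),(3,5),(4,5),(5,6)] : Prop))

/-- The graph `G₇,₆` of the paper. -/
def G76graph : SimpleGraph (Fin 7) :=
  SimpleGraph.fromRel (fun u v => ((u.val, v.val) ∈
    [(0,1),(0,6),(1,2),(1,6),(2,3),(2,4),(3,4),(3,5),(4,5),(5,6)] : Prop))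

/-- The graph `G₁₁` of the paper, with vertices `0,…,10` standing for `1,…,11`. -/
def G11graph : SimpleGraph (Fin 11) :=
  SimpleGraph.fromRel (fun u v => ((u.val, v.val) ∈
    [(0,1),(0,10),(1,10),(1,2),(2,3),(2,8),(3,4),(3,9),(4,5),(5,6),(6,7),(7,8),
     (8,9),(9,10)] : Prop))

/-- The graph `G₁₅` of the paper, with vertices `0,…,14` standing for `1,…,15`. -/
def G15graph : SimpleGraph (Fin 15) :=
  SimpleGraph.fromRel (fun u v => ((u.val, v.val) ∈
    [(0,1),(0,14),(1,14),(1,2),(2,3),(2,12),(3,11),(11,4),(3,13),(4,5),(4,9),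
     (5,6),(5,10),(6,7),(6,8),(7,8),(8,9),(9,10),(10,12),(12,13),(13,14)] : Prop))

namespace P3I

/-! ## Part 1: bit tables -/

/-- Bit `(i,j)` of a table with rows of width 32. -/
def tb (A i j : Nat) : Bool := Nat.testBit A (32 * i + j)

/-- Set difference of bit sets. -/
def diff (x y : Nat) : Nat := x ^^^ (x &&& y)

/-- Row `i` of a table. -/
def row (A i : Nat) : Nat := (A >>> (32 * i)) &&& 4294967295

/-- The list of bits of `x` (complete when `x < 2 ^ fuel`). -/
def bits : Nat → Nat → List Nat
  | 0, _ => []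
  | f + 1, x => bif Nat.beq x 0 then [] else
      Nat.log2 x :: bits f (x ^^^ (1 <<< Nat.log2 x))

def pc (x : Nat) : Nat := (bits 32 x).length

/-- The exceptional graphs as pairs (order, adjacency table). -/
def excs : List (Nat × Nat) := 
  [(3, 36893488168893939714),
   (3, 55340232242603491334),
   (7, 207144357384680596206664579100569880137685109729687920181314),
   (7, 6277101760232208613433563178776164215432551603421491232866),
   (7, 18831305231005570141105142025191497047637262492624438165602),
   (7, 56493915643325654724119878569508097945164312765120580157538),
   (7, 69048119114099016251791457415923430777369023654323527090274),
   (7, 219698560867145970831622251826198588378289963653087310643266),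
   (7, 219698560867145970834344510762833746686225189914038159540290),
   (11, 1095761350064000614947279974344379060424696066715179238910590304974014400464161279548016449833403394),
   (11, 1100033324139821021003811479250910487420770326420730945288276249867885678806237692667529455724397570),
   (15, 5956443349069689428690096106376845685972055471653442732802859447441233086097607141895653022410246276407183641128125136930710372080636936194)]

/-! ## Part 2: the graph-theoretic reduction lemma -/

universe u

open scoped Classical in
/-- Connectivity of a vertex set, in terms of cuts. -/
def CC {V : Type u} (G : SimpleGraph V) (C : Finset V) : Prop :=
  C.Nonempty ∧ ∀ X ⊆ C, X.Nonempty → (∀ a ∈ X, ∀ b ∈ C, G.Adj a b → b ∈ X) → X = C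

def Dom {V : Type u} (G : SimpleGraph V) (D : Finset V) (v : V) : Prop :=
  v ∈ D ∨ ∃ d ∈ D, G.Adj d v

/-- `D` isolates all 3-vertex paths inside `U`. -/
def IsolOn {V : Type u} (G : SimpleGraph V) (U D : Finset V) : Prop :=
  ∀ b ∈ U, ∀ a ∈ U, ∀ c ∈ U, ¬ Dom G D a → ¬ Dom G D b → ¬ Dom G D c →
    G.Adj b a → G.Adj b c → a = c

/-- `φ` is an isomorphism of the table graph `(m, T)` with the graph induced by `C`. -/
structure IsCopy {V : Type u} (G : SimpleGraph V) (C : Finset V) (m T : Nat) (φ : Nat → V) :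
    Prop where
  mem : ∀ i < m, φ i ∈ C
  inj : ∀ i < m, ∀ j < m, φ i = φ j → i = j
  surj : ∀ c ∈ C, ∃ i < m, φ i = c
  adj : ∀ i < m, ∀ j < m, (G.Adj (φ i) (φ j) ↔ tb T i j = true)

def ExcOn {V : Type u} (G : SimpleGraph V) (C : Finset V) : Prop :=
  ∃ e ∈ excs, ∃ φ : Nat → V, IsCopy G C e.1 e.2 φ

structure IsComp {V : Type u} (G : SimpleGraph V) (S C : Finset V) : Prop where
  cc : CC G C
  disj : ∀ a ∈ C, a ∉ S
  out : ∀ a ∈ C, ∀ b, b ∉ C → G.Adj a b → b ∈ S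

/-- A minimal counterexample. -/
structure Min {V : Type u} [Fintype V] (G : SimpleGraph V) : Prop where
  conn : CC G Finset.univ
  deg : ∀ v, ∀ s : Finset V, (∀ w ∈ s, G.Adj v w) → s.card ≤ 3
  noc6 : ¬ hasInducedC6 G
  nexc : ¬ ExcOn G Finset.univ
  ngood : ¬ ∃ D : Finset V, 4 * D.card ≤ Fintype.card V ∧ IsolOn G Finset.univ D
  ih : ∀ C : Finset V, C ≠ Finset.univ → CC G C → ¬ ExcOn G C →
    ∃ D ⊆ C, 4 * D.card ≤ C.card ∧ IsolOn G C D

section reduction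
open scoped Classical
variable {V : Type u} {G : SimpleGraph V}

theorem Dom.mono {D D' : Finset V} (h : D ⊆ D') {v : V} (hv : Dom G D v) : Dom G D' v := by
  rcases hv with hv | ⟨d, hd, ha⟩
  · exact Or.inl (h hv)
  · exact Or.inr ⟨d, h hd, ha⟩

theorem IsComp.mem_of_adj {S C : Finset V} (h : IsComp G S C) {a b : V} (ha : a ∈ C)
    (hab : G.Adj a b) (hb : b ∉ S) : b ∈ C := by
  by_contra hc
  exact hb (h.out a ha b hc hab)

theorem IsComp.subset {S C C' : Finset V} (h : IsComp G S C) (h' : IsComp G S C') {x : V}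
    (hx : x ∈ C) (hx' : x ∈ C') : C ⊆ C' := by
  have := h.cc.2 (C ∩ C') Finset.inter_subset_left ⟨x, by simp [hx, hx']⟩ (by
    intro a ha b hb hab
    simp only [Finset.mem_inter] at ha ⊢
    exact ⟨hb, h'.mem_of_adj ha.2 hab (h.disj b hb)⟩)
  rw [← this]
  exact Finset.inter_subset_right

theorem IsComp.eq {S C C' : Finset V} (h : IsComp G S C) (h' : IsComp G S C') {x : V}
    (hx : x ∈ C) (hx' : x ∈ C') : C = C' :=
  Finset.Subset.antisymm (h.subset h' hx hx') (h'.subset h hx' hx)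

variable [Fintype V]

theorem comp_exists (S : Finset V) (x : V) (hx : x ∉ S) : ∃ C, x ∈ C ∧ IsComp G S C := by
  let r : V → V → Prop := fun a b => G.Adj a b ∧ b ∉ S
  have hmem : ∀ y, y ∈ Finset.univ.filter (fun y => Relation.ReflTransGen r x y) ↔
      Relation.ReflTransGen r x y := by intro y; simp
  refine ⟨Finset.univ.filter (fun y => Relation.ReflTransGen r x y), ?_, ?_, ?_, ?_⟩
  · rw [hmem]
  · refine ⟨⟨x, by rw [hmem]⟩, ?_⟩
    intro X hX ⟨a0, ha0⟩ hcl
    have key : ∀ y, Relation.ReflTransGen r x y → (x ∈ X ↔ y ∈ X) := by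
      intro y hy
      induction hy with
      | refl => rfl
      | tail hxa hab ih =>
        rename_i a b
        rw [ih]
        constructor
        · intro ha
          exact hcl a ha b ((hmem b).2 (hxa.tail hab)) hab.1
        · intro hb
          exact hcl b hb a ((hmem a).2 hxa) hab.1.symm
    have hx0 : x ∈ X := (key a0 ((hmem a0).1 (hX ha0))).2 ha0
    apply Finset.Subset.antisymm hX
    intro y hy
    exact (key y ((hmem y).1 hy)).1 hx0
  · intro a ha
    rw [hmem] at ha
    cases ha with
    | refl => exact hx
    | tail _ h => exact h.2
  · intro a ha b hb hab
    by_contra hbS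
    exact hb ((hmem b).2 (((hmem a).1 ha).tail ⟨hab, hbS⟩))

/-- Exceptional graphs: isolation numbers (proved in Part 3 by computation). -/
def ExcFacts : Prop := ∀ (V : Type u) (G : SimpleGraph V) (C : Finset V), ExcOn G C →
    (∃ D ⊆ C, 4 * D.card ≤ C.card + 1 ∧ IsolOn G C D) ∧
    (∀ y ∈ C, ∃ D ⊆ C, 4 * D.card + 3 ≤ C.card ∧ IsolOn G (C.erase y) D)

theorem key0 (hx : ExcFacts.{u}) (hm : Min G) (S D : Finset V) (hS : S.Nonempty)
    (_hDS : D ⊆ S)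
    (h1 : ∀ a ∈ S, ¬ Dom G D a → ∀ w, G.Adj a w → ¬ Dom G D w → w ∈ S)
    (h2 : ∀ b ∈ S, ¬ Dom G D b → ∀ a c, G.Adj b a → G.Adj b c → ¬ Dom G D a → ¬ Dom G D c →
      a = c) :
    S.card + 3 * (Finset.univ.filter (fun C => IsComp G S C ∧ ExcOn G C ∧
        ∃ c ∈ C, Dom G D c)).card <
      4 * D.card + (Finset.univ.filter (fun C => IsComp G S C ∧ ExcOn G C ∧
        ¬ ∃ c ∈ C, Dom G D c)).card := by
  by_contra hlt
  rw [not_lt] at hlt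
  have hf : ∀ C : Finset V, ∃ F : Finset V, IsComp G S C → (F ⊆ C ∧
      4 * F.card + 3 * (if ExcOn G C ∧ (∃ c ∈ C, Dom G D c) then 1 else 0) ≤
        C.card + (if ExcOn G C ∧ (¬ ∃ c ∈ C, Dom G D c) then 1 else 0) ∧
      IsolOn G (C.filter (fun v => ¬ Dom G D v)) F) := by
    intro C
    by_cases hC : IsComp G S C
    swap
    · exact ⟨∅, fun h => absurd h hC⟩
    have hne : C ≠ Finset.univ := by
      rintro rfl
      obtain ⟨s, hs⟩ := hS
      exact hC.disj s (Finset.mem_univ s) hs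
    by_cases he : ExcOn G C
    · by_cases ht : ∃ c ∈ C, Dom G D c
      · obtain ⟨y, hy, hyD⟩ := ht
        obtain ⟨F, hF, hc, hi⟩ := (hx V G C he).2 y hy
        refine ⟨F, fun _ => ⟨hF, ?_, ?_⟩⟩
        · have ht : ∃ c ∈ C, Dom G D c := ⟨y, hy, hyD⟩
          rw [if_pos ⟨he, ht⟩]
          omega
        · intro b hb a ha c hc
          simp only [Finset.mem_filter] at ha hb hc
          have hh : ∀ z, z ∈ C ∧ ¬ Dom G D z → z ∈ C.erase y := by
            rintro z ⟨hz, hzD⟩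
            rw [Finset.mem_erase]
            exact ⟨fun h => hzD (h ▸ hyD), hz⟩
          exact hi b (hh b hb) a (hh a ha) c (hh c hc)
      · obtain ⟨F, hF, hc, hi⟩ := (hx V G C he).1
        refine ⟨F, fun _ => ⟨hF, ?_, ?_⟩⟩
        · rw [if_neg (fun h => ht h.2), if_pos ⟨he, ht⟩]
          omega
        · intro b hb a ha c hc
          simp only [Finset.mem_filter] at ha hb hc
          exact hi b hb.1 a ha.1 c hc.1
    · obtain ⟨F, hF, hc, hi⟩ := hm.ih C hne hC.cc he
      refine ⟨F, fun _ => ⟨hF, ?_, ?_⟩⟩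
      · rw [if_neg (fun h => he h.1), if_neg (fun h => he h.1)]
        omega
      · intro b hb a ha c hc
        simp only [Finset.mem_filter] at ha hb hc
        exact hi b hb.1 a ha.1 c hc.1
  choose f hf using hf
  let cs : Finset (Finset V) := Finset.univ.filter (fun C => IsComp G S C)
  have hcs : ∀ C, C ∈ cs ↔ IsComp G S C := by intro C; simp [cs]
  apply hm.ngood
  refine ⟨D ∪ cs.biUnion f, ?_, ?_⟩
  · have e1 : (D ∪ cs.biUnion f).card ≤ D.card + ∑ C ∈ cs, (f C).card :=
      (Finset.card_union_le _ _).trans (Nat.add_le_add_left Finset.card_biUnion_le _)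
    have e2 : ∑ C ∈ cs, (4 * (f C).card + 3 * (if ExcOn G C ∧ (∃ c ∈ C, Dom G D c) then 1 else 0))
        ≤ ∑ C ∈ cs, (C.card + (if ExcOn G C ∧ (¬ ∃ c ∈ C, Dom G D c) then 1 else 0)) := by
      apply Finset.sum_le_sum
      intro C hC
      exact (hf C ((hcs C).1 hC)).2.1
    have e3 : ∑ C ∈ cs, C.card ≤ (Sᶜ).card := by
      have hd : (cs : Set (Finset V)).PairwiseDisjoint id := by
        intro C hC C' hC' hne
        rw [Function.onFun, Finset.disjoint_left]
        intro x hx hx'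
        exact hne (((hcs C).1 hC).eq ((hcs C').1 hC') hx hx')
      have := Finset.card_biUnion (s := cs) (t := id) hd
      simp only [id] at this
      rw [← this]
      apply Finset.card_le_card
      intro x hx
      rw [Finset.mem_biUnion] at hx
      obtain ⟨C, hC, hxC⟩ := hx
      rw [Finset.mem_compl]
      exact ((hcs C).1 hC).disj x hxC
    rw [Finset.sum_add_distrib, Finset.sum_add_distrib, ← Finset.mul_sum, ← Finset.mul_sum,
      ← Finset.card_filter, ← Finset.card_filter, Finset.filter_filter, Finset.filter_filter] at e2
    rw [Finset.card_compl] at e3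
    have e4 := Finset.card_le_univ S
    omega
  · intro b _ a _ c _ ha hb hc hba hbc
    have hD : D ⊆ D ∪ cs.biUnion f := Finset.subset_union_left
    have hD' : ∀ z, ¬ Dom G (D ∪ cs.biUnion f) z → ¬ Dom G D z := fun z hz h => hz (h.mono hD)
    by_cases hbS : b ∈ S
    · exact h2 b hbS (hD' b hb) a c hba hbc (hD' a ha) (hD' c hc)
    · have haS : a ∉ S := fun h => hbS (h1 a h (hD' a ha) b hba.symm (hD' b hb))
      have hcS : c ∉ S := fun h => hbS (h1 c h (hD' c hc) b hbc.symm (hD' b hb))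
      obtain ⟨C, hbC, hC⟩ := comp_exists (G := G) S b hbS
      have haC := hC.mem_of_adj hbC hba haS
      have hcC := hC.mem_of_adj hbC hbc hcS
      have hfD : f C ⊆ D ∪ cs.biUnion f :=
        (Finset.subset_biUnion_of_mem f ((hcs C).2 hC)).trans Finset.subset_union_right
      have hF : ∀ z, ¬ Dom G (D ∪ cs.biUnion f) z → ¬ Dom G (f C) z :=
        fun z hz h => hz (h.mono hfD)
      exact (hf C hC).2.2 b (by simp [hbC, hD' b hb]) a (by simp [haC, hD' a ha]) c
        (by simp [hcC, hD' c hc]) (hF a ha) (hF b hb) (hF c hc) hba hbc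

theorem edge_out (hm : Min G) {S C : Finset V} (hS : S.Nonempty) (hC : IsComp G S C) :
    ∃ s ∈ S, ∃ c ∈ C, G.Adj s c := by
  by_contra hno
  have : C = Finset.univ := by
    apply hm.conn.2 C (Finset.subset_univ _) hC.cc.1
    intro a ha b _ hab
    apply hC.mem_of_adj ha hab
    intro hb
    exact hno ⟨b, hb, a, ha, hab.symm⟩
  obtain ⟨s, hs⟩ := hS
  exact hC.disj s (this ▸ Finset.mem_univ s) hs

theorem two_ends (hx : ExcFacts.{u}) (hm : Min G) {S C : Finset V} (hS : S.Nonempty)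
    (hC : IsComp G S C) (he : ExcOn G C) :
    ∃ s ∈ S, ∃ t ∈ S, s ≠ t ∧ (∃ c ∈ C, G.Adj s c) ∧ (∃ c ∈ C, G.Adj t c) := by
  obtain ⟨s, hs, c, hc, hsc⟩ := edge_out hm hS hC
  by_contra hno
  have hall : ∀ t ∈ S, ∀ c ∈ C, G.Adj t c → t = s := by
    intro t ht c' hc' htc
    by_contra hne
    exact hno ⟨s, hs, t, ht, fun h => hne h.symm, ⟨c, hc, hsc⟩, ⟨c', hc', htc⟩⟩
  have hC1 : IsComp G {s} C := ⟨hC.cc, fun a ha h => hC.disj a ha (by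
    rw [Finset.mem_singleton] at h; exact h ▸ hs), fun a ha b hb hab => by
    rw [Finset.mem_singleton]
    exact hall b (hC.out a ha b hb hab) a ha hab.symm⟩
  have := key0 hx hm {s} {s} (by simp) (by simp)
    (by intro a ha hd; exact absurd (Or.inl ha) hd)
    (by intro a ha hd; exact absurd (Or.inl ha) hd)
  have h0 : (Finset.univ.filter (fun C => IsComp G {s} C ∧ ExcOn G C ∧
        ¬ ∃ c ∈ C, Dom G {s} c)).card = 0 := by
    rw [Finset.card_eq_zero, Finset.filter_eq_empty_iff]
    rintro C' - ⟨hC', -, hno'⟩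
    obtain ⟨t, ht, c', hc', htc⟩ := edge_out hm (by simp) hC'
    exact hno' ⟨c', hc', Or.inr ⟨t, ht, htc⟩⟩
  have h1 : 0 < (Finset.univ.filter (fun C => IsComp G {s} C ∧ ExcOn G C ∧
        ∃ c ∈ C, Dom G {s} c)).card := by
    rw [Finset.card_pos]
    refine ⟨C, ?_⟩
    simp only [Finset.mem_filter, Finset.mem_univ, true_and]
    exact ⟨hC1, he, c, hc, Or.inr ⟨s, by simp, hsc⟩⟩
  simp only [Finset.card_singleton] at this
  omega

theorem reduce (hx : ExcFacts.{u}) (hm : Min G) (S D T : Finset V) (hS : S.Nonempty)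
    (hDS : D ⊆ S)
    (h1 : ∀ a ∈ S, ¬ Dom G D a → ∀ w, G.Adj a w → ¬ Dom G D w → w ∈ S)
    (h2 : ∀ b ∈ S, ¬ Dom G D b → ∀ a c, G.Adj b a → G.Adj b c → ¬ Dom G D a → ¬ Dom G D c →
      a = c)
    (hT : ∀ C, IsComp G S C → ExcOn G C → (∀ c ∈ C, ¬ Dom G D c) → ∀ c ∈ C, c ∉ T)
    (hcount : 8 * D.card + ∑ s ∈ S \ D, (Finset.univ.filter
      (fun w => G.Adj s w ∧ w ∉ S ∧ w ∉ T)).card ≤ 2 * S.card + 1) : False := by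
  have h := key0 hx hm S D hS hDS h1 h2
  set bad := Finset.univ.filter (fun C => IsComp G S C ∧ ExcOn G C ∧ ¬ ∃ c ∈ C, Dom G D c)
    with hbad
  have hb : ∀ C, C ∈ bad → IsComp G S C ∧ ExcOn G C ∧ (∀ c ∈ C, ¬ Dom G D c) := by
    intro C hC
    rw [hbad, Finset.mem_filter] at hC
    refine ⟨hC.2.1, hC.2.2.1, fun c hc hd => hC.2.2.2 ⟨c, hc, hd⟩⟩
  have e1 : ∑ C ∈ bad, 2 ≤ ∑ C ∈ bad, ∑ s ∈ S \ D, (C.filter (fun w => G.Adj s w)).card := by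
    apply Finset.sum_le_sum
    intro C hC
    obtain ⟨hC1, hC2, hC3⟩ := hb C hC
    obtain ⟨s, hs, t, ht, hst, ⟨c, hc, hsc⟩, ⟨c', hc', htc⟩⟩ := two_ends hx hm hS hC1 hC2
    have hsD : s ∉ D := fun hd => hC3 c hc (Or.inr ⟨s, hd, hsc⟩)
    have htD : t ∉ D := fun hd => hC3 c' hc' (Or.inr ⟨t, hd, htc⟩)
    have hsub : ({s, t} : Finset V) ⊆ S \ D := by
      intro z hz
      simp only [Finset.mem_insert, Finset.mem_singleton] at hz
      rcases hz with rfl | rfl <;> simp [*]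
    refine le_trans ?_ (Finset.sum_le_sum_of_subset hsub)
    rw [Finset.sum_pair hst]
    have a1 : 0 < (C.filter (fun w => G.Adj s w)).card :=
      Finset.card_pos.2 ⟨c, by simp [hc, hsc]⟩
    have a2 : 0 < (C.filter (fun w => G.Adj t w)).card :=
      Finset.card_pos.2 ⟨c', by simp [hc', htc]⟩
    omega
  have e2 : ∑ C ∈ bad, ∑ s ∈ S \ D, (C.filter (fun w => G.Adj s w)).card ≤
      ∑ s ∈ S \ D, (Finset.univ.filter (fun w => G.Adj s w ∧ w ∉ S ∧ w ∉ T)).card := by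
    rw [Finset.sum_comm]
    apply Finset.sum_le_sum
    intro s _
    rw [← Finset.card_biUnion]
    · apply Finset.card_le_card
      intro w hw
      rw [Finset.mem_biUnion] at hw
      obtain ⟨C, hC, hw⟩ := hw
      rw [Finset.mem_filter] at hw
      obtain ⟨hC1, hC2, hC3⟩ := hb C hC
      simp only [Finset.mem_filter, Finset.mem_univ, true_and]
      exact ⟨hw.2, hC1.disj w hw.1, hT C hC1 hC2 hC3 w hw.1⟩
    · intro C hC C' hC' hne
      rw [Function.onFun, Finset.disjoint_left]
      intro w hw hw'
      rw [Finset.mem_filter] at hw hw'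
      exact hne ((hb C hC).1.eq (hb C' hC').1 hw.1 hw'.1)
  rw [Finset.sum_const, smul_eq_mul] at e1
  omega

end reduction

/-! ## Part 3: bit set lemmas -/

section bitlemmas

theorem beq_iff (a b : Nat) : Nat.beq a b = true ↔ a = b := by
  constructor
  · exact Nat.eq_of_beq_eq_true
  · rintro rfl
    exact Nat.beq_refl a


theorem tb_or (x y i j : Nat) : tb (x ||| y) i j = (tb x i j || tb y i j) := by
  simp [tb, Nat.testBit_or]

theorem testBit_diff (x y i : Nat) :
    (diff x y).testBit i = (x.testBit i && !y.testBit i) := by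
  simp only [diff, Nat.testBit_xor, Nat.testBit_and]
  cases x.testBit i <;> cases y.testBit i <;> rfl

theorem tb_diff (x y i j : Nat) : tb (diff x y) i j = (tb x i j && !tb y i j) := by
  simp only [tb, testBit_diff]

theorem testBit_one_shl (k i : Nat) : (1 <<< k).testBit i = true ↔ i = k := by
  rw [Nat.one_shiftLeft, Nat.testBit_two_pow]
  simp [eq_comm]

theorem row_bit (A i j : Nat) : (row A i).testBit j = true ↔ j < 32 ∧ tb A i j = true := by
  have h : (4294967295 : Nat) = 2 ^ 32 - 1 := by norm_num
  rw [row, h, Nat.testBit_and, Nat.testBit_two_pow_sub_one, Nat.testBit_shiftRight, tb]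
  simp [and_comm]

theorem bits_mem : ∀ (f x : Nat), x < 2 ^ f → ∀ i, i ∈ bits f x ↔ x.testBit i = true := by
  intro f
  induction f with
  | zero =>
    intro x hx i
    have : x = 0 := by simpa using hx
    simp [this, bits]
  | succ f ih =>
    intro x hx i
    rw [bits]
    by_cases h0 : x = 0
    · simp [h0]
    · have hb : Nat.beq x 0 = false := by
        rw [← Bool.not_eq_true, beq_iff]; exact h0
      rw [hb, cond_false]
      have hl : x.testBit (Nat.log2 x) = true := Nat.testBit_log2 h0
      have hlt : x ^^^ (1 <<< Nat.log2 x) < 2 ^ f := by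
        have h1 : Nat.log2 x ≤ f := by
          have := (Nat.log2_lt h0).2 hx
          omega
        apply Nat.lt_pow_two_of_testBit
        intro i hi
        rw [Nat.testBit_xor]
        by_cases he : i = Nat.log2 x
        · subst he
          rw [hl, (testBit_one_shl _ _).2 rfl]; rfl
        · have h2 : x.testBit i = false := by
            apply Nat.testBit_lt_two_pow
            apply (Nat.log2_lt h0).1
            omega
          have h3 : (1 <<< Nat.log2 x).testBit i = false := by
            rw [← Bool.not_eq_true, testBit_one_shl]; exact he
          rw [h2, h3]; rfl
      rw [List.mem_cons, ih _ hlt, Nat.testBit_xor]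
      by_cases he : i = Nat.log2 x
      · subst he
        simp [hl]
      · have h3 : (1 <<< Nat.log2 x).testBit i = false := by
            rw [← Bool.not_eq_true, testBit_one_shl]; exact he
        simp [h3, he]

theorem bits_nodup : ∀ (f x : Nat), x < 2 ^ f → (bits f x).Nodup := by
  intro f
  induction f with
  | zero => intro x _; simp [bits]
  | succ f ih =>
    intro x hx
    have hm := bits_mem (f + 1) x hx
    rw [bits]
    by_cases h0 : x = 0
    · simp [h0]
    · have hb : Nat.beq x 0 = false := by
        rw [← Bool.not_eq_true, beq_iff]; exact h0
      rw [hb, cond_false]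
      have hl : x.testBit (Nat.log2 x) = true := Nat.testBit_log2 h0
      have hlt : x ^^^ (1 <<< Nat.log2 x) < 2 ^ f := by
        have h1 : Nat.log2 x ≤ f := by
          have := (Nat.log2_lt h0).2 hx
          omega
        apply Nat.lt_pow_two_of_testBit
        intro i hi
        rw [Nat.testBit_xor]
        by_cases he : i = Nat.log2 x
        · subst he
          rw [hl, (testBit_one_shl _ _).2 rfl]; rfl
        · have h2 : x.testBit i = false := by
            apply Nat.testBit_lt_two_pow
            apply (Nat.log2_lt h0).1
            omega
          have h3 : (1 <<< Nat.log2 x).testBit i = false := by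
            rw [← Bool.not_eq_true, testBit_one_shl]; exact he
          rw [h2, h3]; rfl
      rw [List.nodup_cons, bits_mem f _ hlt]
      refine ⟨?_, ih _ hlt⟩
      rw [Nat.testBit_xor, hl, (testBit_one_shl _ _).2 rfl]
      simp

theorem lt_of_bit {x n i : Nat} (hx : x < 2 ^ n) (hi : x.testBit i = true) : i < n := by
  by_contra hc
  have : x.testBit i = false := Nat.testBit_lt_two_pow
    (lt_of_lt_of_le hx (Nat.pow_le_pow_right (by norm_num) (by omega)))
  rw [this] at hi
  exact Bool.noConfusion hi

/-- A bit set with at most one element. -/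
def le1 (x : Nat) : Bool := Nat.beq x 0 || Nat.beq x (1 <<< Nat.log2 x)

theorem le1_eq {x i j : Nat} (h : le1 x = true) (hi : x.testBit i = true)
    (hj : x.testBit j = true) : i = j := by
  simp only [le1, Bool.or_eq_true, beq_iff] at h
  rcases h with h | h
  · rw [h] at hi; simp at hi
  · rw [h] at hi hj
    rw [testBit_one_shl] at hi hj
    rw [hi, hj]

/-- `x ⊆ y` for bit sets. -/
def sub (x y : Nat) : Bool := Nat.beq (x &&& y) x

theorem sub_bit {x y i : Nat} (h : sub x y = true) (hi : x.testBit i = true) :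
    y.testBit i = true := by
  simp only [sub, beq_iff] at h
  rw [← h, Nat.testBit_and, Bool.and_eq_true] at hi
  exact hi.2

/-- Bounded universal quantification. -/
def allLt : Nat → (Nat → Bool) → Bool
  | 0, _ => true
  | n + 1, f => f n && allLt n f

theorem allLt_iff (n : Nat) (f : Nat → Bool) : allLt n f = true ↔ ∀ i < n, f i = true := by
  induction n with
  | zero => simp [allLt]
  | succ n ih =>
    rw [allLt, Bool.and_eq_true, ih]
    constructor
    · rintro ⟨h1, h2⟩ i hi
      rcases Nat.lt_succ_iff_lt_or_eq.1 hi with h | h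
      · exact h2 i h
      · exact h ▸ h1
    · intro h
      exact ⟨h n (Nat.lt_succ_self n), fun i hi => h i (Nat.lt_succ_of_lt hi)⟩

/-- The mask of all numbers below `n`. -/
def full (n : Nat) : Nat := 1 <<< n - 1

theorem full_bit (n i : Nat) : (full n).testBit i = true ↔ i < n := by
  rw [full, Nat.one_shiftLeft, Nat.testBit_two_pow_sub_one]
  simp

theorem full_lt (n : Nat) : full n < 2 ^ n := by
  rw [full, Nat.one_shiftLeft]
  have : 0 < 2 ^ n := by positivity
  omega

theorem lt_of_sub_full {x n : Nat} (h : sub x (full n) = true) : x < 2 ^ n := by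
  simp only [sub, beq_iff] at h
  rw [← h]
  exact lt_of_le_of_lt Nat.and_le_right (full_lt n)

/-- The union of the rows of the bits in `L`. -/
def rows (A : Nat) : List Nat → Nat
  | [] => 0
  | i :: l => row A i ||| rows A l

theorem rows_bit (A : Nat) (l : List Nat) (j : Nat) :
    (rows A l).testBit j = true ↔ ∃ i ∈ l, j < 32 ∧ tb A i j = true := by
  induction l with
  | nil => simp [rows]
  | cons i l ih =>
    rw [rows, Nat.testBit_or, Bool.or_eq_true, ih, row_bit]
    simp

theorem lt_pow32 {x n : Nat} (hx : x < 2 ^ n) (hn : n ≤ 32) : x < 2 ^ 32 :=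
  lt_of_lt_of_le hx (Nat.pow_le_pow_right (by norm_num) hn)

open scoped Classical in
/-- The set of vertices corresponding to a bit set. -/
noncomputable def img {V : Type u} (φ : Nat → V) (x : Nat) : Finset V :=
  (bits 32 x).toFinset.image φ

theorem mem_img {V : Type u} {φ : Nat → V} {x n : Nat} (hx : x < 2 ^ n) (hn : n ≤ 32) {v : V} :
    v ∈ img φ x ↔ ∃ i, x.testBit i = true ∧ φ i = v := by
  simp [img, bits_mem 32 x (lt_pow32 hx hn)]

theorem card_img {V : Type u} {φ : Nat → V} {x n : Nat} (hx : x < 2 ^ n) (hn : n ≤ 32)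
    (hφ : ∀ i < n, ∀ j < n, φ i = φ j → i = j) : (img φ x).card = pc x := by
  classical
  have hx' := lt_pow32 hx hn
  have h1 : (img φ x).card = ((bits 32 x).toFinset).card := by
    unfold img
    convert Finset.card_image_of_injOn _
    intro i hi j hj h
    simp only [List.coe_toFinset, Set.mem_ofPred_eq, bits_mem 32 x hx'] at hi hj
    exact hφ i (lt_of_bit hx hi) j (lt_of_bit hx hj) h
  rw [h1, List.toFinset_card_of_nodup (bits_nodup 32 x hx'), pc]

theorem sum_img {V : Type u} {φ : Nat → V} {x n : Nat} (hx : x < 2 ^ n) (hn : n ≤ 32)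
    (hφ : ∀ i < n, ∀ j < n, φ i = φ j → i = j) (f : V → Nat) :
    ∑ v ∈ img φ x, f v = ((bits 32 x).map (fun i => f (φ i))).sum := by
  classical
  have hx' := lt_pow32 hx hn
  rw [← List.sum_toFinset _ (bits_nodup 32 x hx')]
  unfold img
  convert Finset.sum_image _
  intro i hi j hj h
  simp only [List.coe_toFinset, Set.mem_ofPred_eq, bits_mem 32 x hx'] at hi hj
  exact hφ i (lt_of_bit hx hi) j (lt_of_bit hx hj) h

end bitlemmas

/-! ## Part 4: isolation numbers of the exceptional graphs -/

/-- `D` isolates the table graph on the bit set `R`. -/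
def isoChk (T R D : Nat) : Bool :=
  let nd := D ||| rows T (bits 32 D)
  (bits 32 (diff R nd)).all fun b => le1 (diff (row T b &&& R) nd)

def excChk (e : Nat × Nat) (d : Nat × List Nat) : Bool :=
  sub d.1 (full e.1) && Nat.ble (4 * pc d.1) (e.1 + 1) && isoChk e.2 (full e.1) d.1 &&
  allLt e.1 fun y =>
    sub (d.2.getD y 0) (full e.1) && Nat.ble (4 * pc (d.2.getD y 0) + 3) e.1 &&
    isoChk e.2 (diff (full e.1) (1 <<< y)) (d.2.getD y 0)

theorem excs_small : ∀ e ∈ excs, e.1 ≤ 15 ∧ e.1 % 4 = 3 := by decide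

theorem IsCopy.card {V : Type u} {G : SimpleGraph V} {C : Finset V} {m T : Nat} {φ : Nat → V}
    (h : IsCopy G C m T φ) : C.card = m := by
  classical
  have : C = (Finset.range m).image φ := by
    ext c
    simp only [Finset.mem_image, Finset.mem_range]
    constructor
    · exact h.surj c
    · rintro ⟨i, hi, rfl⟩
      exact h.mem i hi
  rw [this, Finset.card_image_of_injOn, Finset.card_range]
  intro i hi j hj hij
  exact h.inj i (by simpa using hi) j (by simpa using hj) hij

theorem isoChk_sound {V : Type u} {G : SimpleGraph V} {C U : Finset V} {m T R D : Nat}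
    {φ : Nat → V} (h : IsCopy G C m T φ) (hm : m ≤ 32) (hD : D < 2 ^ m) (hR : R < 2 ^ m)
    (hU : ∀ v ∈ U, ∃ i, R.testBit i = true ∧ φ i = v)
    (hc : isoChk T R D = true) : IsolOn G U (img φ D) := by
  have hnd : ∀ i < m, ¬ Dom G (img φ D) (φ i) →
      (D ||| rows T (bits 32 D)).testBit i = false := by
    intro i hi hn
    rw [← Bool.not_eq_true]
    intro hb
    apply hn
    rw [Nat.testBit_or, Bool.or_eq_true, rows_bit] at hb
    rcases hb with hb | ⟨j, hj, _, hji⟩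
    · exact Or.inl ((mem_img hD hm).2 ⟨i, hb, rfl⟩)
    · rw [bits_mem 32 D (lt_pow32 hD hm)] at hj
      exact Or.inr ⟨φ j, (mem_img hD hm).2 ⟨j, hj, rfl⟩,
        (h.adj j (lt_of_bit hD hj) i hi).2 hji⟩
  intro b hb a ha c hc' hda hdb hdc hba hbc
  obtain ⟨i, hi, rfl⟩ := hU b hb
  obtain ⟨j, hj, rfl⟩ := hU a ha
  obtain ⟨k, hk, rfl⟩ := hU c hc'
  have hi' := lt_of_bit hR hi
  have hj' := lt_of_bit hR hj
  have hk' := lt_of_bit hR hk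
  simp only [isoChk, List.all_eq_true] at hc
  have hR' : diff R (D ||| rows T (bits 32 D)) < 2 ^ 32 := by
    apply Nat.lt_pow_two_of_testBit
    intro l hl
    rw [testBit_diff, Nat.testBit_lt_two_pow
      (lt_of_lt_of_le (lt_pow32 hR hm) (Nat.pow_le_pow_right (by norm_num) hl))]
    rfl
  have hb1 := hc i (by
    rw [bits_mem 32 _ hR', testBit_diff, hi, hnd i hi' hdb]; rfl)
  have := le1_eq hb1 (i := j) (j := k) (by
      rw [testBit_diff, Nat.testBit_and, hj, hnd j hj' hda,
        (row_bit T i j).2 ⟨by omega, (h.adj i hi' j hj').1 hba⟩]; rfl) (by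
      rw [testBit_diff, Nat.testBit_and, hk, hnd k hk' hdc,
        (row_bit T i k).2 ⟨by omega, (h.adj i hi' k hk').1 hbc⟩]; rfl)
  rw [this]

theorem excChk_sound {V : Type u} {G : SimpleGraph V} {C : Finset V} {m T : Nat}
    {φ : Nat → V} (h : IsCopy G C m T φ) (hm : m ≤ 32) (d : Nat × List Nat)
    (hc : excChk (m, T) d = true) :
    (∃ D ⊆ C, 4 * D.card ≤ C.card + 1 ∧ IsolOn G C D) ∧
    (∀ y ∈ C, ∃ D ⊆ C, 4 * D.card + 3 ≤ C.card ∧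
      IsolOn G (by classical exact C.erase y) D) := by
  classical
  simp only [excChk, Bool.and_eq_true, allLt_iff, Nat.ble_eq] at hc
  obtain ⟨⟨⟨h1, h2⟩, h3⟩, h4⟩ := hc
  have hsub : ∀ D, D < 2 ^ m → img φ D ⊆ C := by
    intro D hD v hv
    obtain ⟨i, hi, rfl⟩ := (mem_img hD hm).1 hv
    exact h.mem i (lt_of_bit hD hi)
  constructor
  · have hD := lt_of_sub_full h1
    refine ⟨img φ d.1, hsub _ hD, ?_, ?_⟩
    · rw [card_img hD hm h.inj, h.card]; exact h2
    · apply isoChk_sound h hm hD (full_lt m) _ h3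
      intro v hv
      obtain ⟨i, hi, rfl⟩ := h.surj v hv
      exact ⟨i, (full_bit m i).2 hi, rfl⟩
  · intro y hy
    obtain ⟨k, hk, rfl⟩ := h.surj y hy
    obtain ⟨⟨g1, g2⟩, g3⟩ := h4 k hk
    have hD := lt_of_sub_full g1
    refine ⟨img φ (d.2.getD k 0), hsub _ hD, ?_, ?_⟩
    · rw [card_img hD hm h.inj, h.card]; exact g2
    · apply isoChk_sound h hm hD _ _ g3
      · apply Nat.lt_pow_two_of_testBit
        intro l hl
        rw [testBit_diff, Nat.testBit_lt_two_pow
          (lt_of_lt_of_le (full_lt m) (Nat.pow_le_pow_right (by norm_num) hl))]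
        rfl
      · intro v hv
        rw [Finset.mem_erase] at hv
        obtain ⟨i, hi, rfl⟩ := h.surj v hv.2
        refine ⟨i, ?_, rfl⟩
        rw [testBit_diff, (full_bit m i).2 hi]
        have : (1 <<< k).testBit i = false := by
          rw [← Bool.not_eq_true, testBit_one_shl]
          rintro rfl
          exact hv.1 rfl
        rw [this]; rfl

/-- Isolating sets of the exceptional graphs and of their vertex-deleted subgraphs. -/
def excD : List (Nat × List Nat) :=
  [(1, [0, 0, 0]),
   (1, [0, 0, 0]),
   (5, [8, 16, 32, 1, 1, 2, 4]),
   (3, [4, 16, 1, 1, 1, 2, 4]),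
   (3, [4, 16, 1, 1, 1, 2, 4]),
   (3, [4, 8, 1, 1, 1, 4, 4]),
   (3, [4, 8, 1, 1, 1, 2, 4]),
   (5, [4, 8, 32, 2, 2, 2, 4]),
   (5, [4, 8, 32, 2, 2, 2, 4]),
   (67, [132, 264, 65, 65, 65, 130, 260, 9, 17, 33, 66]),
   (21, [20, 40, 528, 129, 257, 5, 5, 9, 17, 34, 20]),
   (53, [52, 56, 8240, 1057, 69, 261, 21, 21, 21, 37, 73, 4161, 2113, 50, 52])]

theorem excD_ok : (excs.zip excD).all (fun p => excChk p.1 p.2) = true := by decide +kernel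

theorem excFacts : ExcFacts.{u} := by
  intro V G C hC
  obtain ⟨e, he, φ, hφ⟩ := hC
  have hd : ∃ d, (e, d) ∈ excs.zip excD := by
    obtain ⟨i, hi, rfl⟩ := List.getElem_of_mem he
    have hl : (excs.zip excD).length = excs.length := by decide
    have hj : i < excD.length := by rw [List.length_zip] at hl; omega
    exact ⟨excD[i], by
      rw [List.mem_iff_getElem]
      exact ⟨i, by omega, by simp⟩⟩
  obtain ⟨d, hd⟩ := hd
  have hok := List.all_eq_true.1 excD_ok _ hd
  have := excs_small e he
  obtain ⟨h1, h2⟩ := excChk_sound hφ (by omega) d hok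
  refine ⟨h1, fun y hy => ?_⟩
  obtain ⟨D, a, b, c⟩ := h2 y hy
  refine ⟨D, a, b, ?_⟩
  convert c


/-! ## Part 5: partial descriptions of a minimal counterexample -/

/-- Evaluate a number before passing it on. -/
def fc {α : Type} (x : Nat) (f : Nat → α) : α :=
  Nat.rec (motive := fun _ => α) (f 0) (fun k _ => f (Nat.succ k)) x

theorem fc_eq {α : Type} (x : Nat) (f : Nat → α) : fc x f = f x := by
  cases x <;> rfl

/-- A partial description: `n` named vertices, certain adjacencies `A`, possible adjacencies `P`,
and the set `Z` of named vertices all of whose neighbours are named. -/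
structure St where
  n : Nat
  A : Nat
  P : Nat
  Z : Nat

def norm {α : Type} (s : St) (f : St → α) : α :=
  fc s.n fun n => fc s.A fun A => fc s.P fun P => fc s.Z fun Z => f ⟨n, A, P, Z⟩

theorem norm_eq {α : Type} (s : St) (f : St → α) : norm s f = f s := by
  simp only [norm, fc_eq]

/-- Row `i` restricted to the named vertices. -/
def rowK (A n i : Nat) : Nat := row A i &&& full n

theorem rowK_bit {A n i j : Nat} (hn : n ≤ 32) :
    (rowK A n i).testBit j = true ↔ j < n ∧ tb A i j = true := by
  rw [rowK, Nat.testBit_and, Bool.and_eq_true, row_bit, full_bit]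
  constructor
  · rintro ⟨⟨_, h⟩, h'⟩; exact ⟨h', h⟩
  · rintro ⟨h, h'⟩; exact ⟨⟨by omega, h'⟩, h⟩

theorem and_full_lt (x n : Nat) : x &&& full n < 2 ^ n :=
  lt_of_le_of_lt Nat.and_le_right (full_lt n)

theorem rowK_lt (A n i : Nat) : rowK A n i < 2 ^ n := and_full_lt _ _

theorem diff_lt {x n : Nat} (y : Nat) (h : x < 2 ^ n) : diff x y < 2 ^ n := by
  apply Nat.lt_pow_two_of_testBit
  intro l hl
  rw [testBit_diff, Nat.testBit_lt_two_pow
    (lt_of_lt_of_le h (Nat.pow_le_pow_right (by norm_num) hl))]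
  rfl

def grow (A R : Nat) : Nat → Nat → Nat
  | 0, c => c
  | f + 1, c => fc (c ||| (rows A (bits 32 c) &&& R)) fun d =>
      bif Nat.beq c d then c else grow A R f d

def compOK (s : St) (nd S h : Nat) (big : Bool) (M : Nat) : Bool :=
  !(Nat.beq (M &&& nd) 0) || (!(Nat.ble (pc M) 15) || ((big && !(Nat.ble (pc M) h)) ||
    (sub M s.Z && (!(Nat.beq (pc M % 4) 3) &&
      sub (rows s.P (bits 32 M) &&& full s.n) (M ||| S)))))

def tset (s : St) (nd S h : Nat) (big : Bool) : Nat → Nat → Nat → Nat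
  | 0, _, T => T
  | f + 1, R, T => bif Nat.beq R 0 then T else
      fc (grow s.A R 32 (1 <<< Nat.log2 R)) fun M =>
      fc (diff R M) fun R' =>
      fc (bif compOK s nd S h big M then T ||| M else T) fun T' =>
      tset s nd S h big f R' T'

def eterm (s : St) (Δ ST x : Nat) : Nat :=
  bif s.Z.testBit x then pc (diff (rowK s.P s.n x) ST) else Δ - pc (rowK s.A s.n x &&& ST)

def isBig (s : St) (Δ D S : Nat) : Bool :=
  Nat.beq Δ 3 && (Nat.beq D (1 <<< Nat.log2 D) && (Nat.beq (pc (rowK s.A s.n (Nat.log2 D))) 3 &&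
    Nat.beq S (D ||| rowK s.A s.n (Nat.log2 D))))

def redOK (Δ h : Nat) (s : St) (D S : Nat) : Bool :=
  fc (D ||| (rows s.A (bits 32 D) &&& full s.n)) fun nd =>
  sub D S && (sub S (full s.n) && (!(Nat.beq S 0) &&
  ((bits 32 (diff S nd)).all (fun u => s.Z.testBit u &&
    fc (diff (rowK s.P s.n u) nd) fun p => sub p S && le1 p) &&
  fc (tset s nd S h (isBig s Δ D S) 32 (diff (full s.n) S) 0) fun T =>
  fc (S ||| T) fun ST =>
  Nat.ble (8 * pc D + ((bits 32 (diff S D)).map (fun x => eterm s Δ ST x)).sum) (2 * pc S + 1))))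

/-- `φ` names vertices of `G` in accordance with `s`. -/
structure Real {V : Type u} (G : SimpleGraph V) (φ : Nat → V) (s : St) : Prop where
  hn : s.n ≤ 32
  inj : ∀ i < s.n, ∀ j < s.n, φ i = φ j → i = j
  a : ∀ i < s.n, ∀ j < s.n, tb s.A i j = true → G.Adj (φ i) (φ j)
  sym : ∀ i < s.n, ∀ j < s.n, tb s.A i j = true → tb s.A j i = true
  p : ∀ i < s.n, ∀ j < s.n, G.Adj (φ i) (φ j) → tb s.P i j = true
  z : ∀ i < s.n, s.Z.testBit i = true → ∀ w, G.Adj (φ i) w → ∃ j < s.n, φ j = w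

/-- The standing assumptions: a minimal counterexample of maximum degree at most `Δ`; `h` bounds
the exceptional components left by closed neighbourhoods of vertices of degree 3. -/
structure Ctx {V : Type u} [Fintype V] (G : SimpleGraph V) (Δ h : Nat) : Prop where
  min : Min G
  deg : ∀ v, ∀ s : Finset V, (∀ w ∈ s, G.Adj v w) → s.card ≤ Δ
  big : Δ = 3 → ∀ (v : V) (N S C : Finset V), N.card = 3 → (∀ w, w ∈ N ↔ G.Adj v w) →
    (∀ w, w ∈ S ↔ (w = v ∨ w ∈ N)) → IsComp G S C → ExcOn G C → C.card ≤ h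

theorem grow_ind {A R : Nat} (hR : R < 2 ^ 32) (Q : Nat → Prop) (hQR : ∀ i, Q i → R.testBit i = true)
    (hQ : ∀ i j, Q i → tb A i j = true → R.testBit j = true → Q j) :
    ∀ f c, (∀ i, c.testBit i = true → Q i) → ∀ i, (grow A R f c).testBit i = true → Q i := by
  intro f
  induction f with
  | zero => intro c hc i hi; exact hc i hi
  | succ f ih =>
    intro c hc i hi
    rw [grow, fc_eq] at hi
    cases hb : Nat.beq c (c ||| (rows A (bits 32 c) &&& R)) with
    | true => rw [hb, cond_true] at hi; exact hc i hi
    | false =>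
      rw [hb, cond_false] at hi
      refine ih _ ?_ i hi
      intro j hj
      rw [Nat.testBit_or, Bool.or_eq_true, Nat.testBit_and, Bool.and_eq_true, rows_bit] at hj
      rcases hj with hj | ⟨⟨k, hk, _, hkj⟩, hj⟩
      · exact hc j hj
      · have hc32 : c < 2 ^ 32 := by
          apply Nat.lt_pow_two_of_testBit
          intro l hl
          rw [← Bool.not_eq_true]
          intro hcl
          have := lt_of_bit hR (hQR l (hc l hcl))
          omega
        rw [bits_mem 32 c hc32] at hk
        exact hQ k j (hc k hk) hkj hj

theorem lt_of_bits {x n : Nat} (h : ∀ i, x.testBit i = true → i < n) : x < 2 ^ n := by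
  apply Nat.lt_pow_two_of_testBit
  intro l hl
  rw [← Bool.not_eq_true]
  intro hx
  have := h l hx
  omega

section sound
open scoped Classical
variable {V : Type u} [Fintype V] {G : SimpleGraph V} {φ : Nat → V} {Δ h : Nat} {s : St}

theorem ExcOn.card {C : Finset V} (hC : ExcOn G C) : C.card ≤ 15 ∧ C.card % 4 = 3 := by
  obtain ⟨e, he, ψ, hψ⟩ := hC
  rw [hψ.card]
  exact excs_small e he

theorem tset_sound (hr : Real G φ s) {S : Finset V} {C : Finset V} {nd Sb : Nat} {big : Bool}
    (hC : IsComp G S C)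
    (hS : ∀ i < s.n, φ i ∈ S → Sb.testBit i = true)
    (hok : ∀ M, (∀ i, M.testBit i = true → i < s.n) → (∀ i, M.testBit i = true → φ i ∈ C) →
      ∀ i, M.testBit i = true → compOK s nd Sb h big M = false) :
    ∀ f R T, (∀ i, R.testBit i = true → i < s.n ∧ φ i ∉ S) →
      (∀ i, T.testBit i = true → i < s.n ∧ φ i ∉ C) →
      ∀ i, (tset s nd Sb h big f R T).testBit i = true → i < s.n ∧ φ i ∉ C := by
  intro f
  induction f with
  | zero => intro R T _ hT; exact hT
  | succ f ih =>
    intro R T hR hT i hi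
    rw [tset] at hi
    by_cases h0 : R = 0
    · have hb : Nat.beq R 0 = true := (beq_iff _ _).2 h0
      rw [hb, cond_true] at hi
      exact hT i hi
    · have hb : Nat.beq R 0 = false := by
        rw [← Bool.not_eq_true, beq_iff]; exact h0
      rw [hb, cond_false, fc_eq, fc_eq, fc_eq] at hi
      have hR32 : R < 2 ^ 32 := lt_of_bits (fun i hi => lt_of_lt_of_le (hR i hi).1 hr.hn)
      have hr0 : R.testBit (Nat.log2 R) = true := Nat.testBit_log2 h0
      set M := grow s.A R 32 (1 <<< Nat.log2 R) with hM
      obtain ⟨C0, hx0, hC0⟩ := comp_exists (G := G) S (φ (Nat.log2 R)) (hR _ hr0).2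
      have hMQ : ∀ i, M.testBit i = true → R.testBit i = true ∧ φ i ∈ C0 := by
        apply grow_ind hR32 (fun i => R.testBit i = true ∧ φ i ∈ C0) (fun i hi => hi.1)
        · rintro a b ⟨ha, haC⟩ hab hb
          exact ⟨hb, hC0.mem_of_adj haC (hr.a a (hR a ha).1 b (hR b hb).1 hab) (hR b hb).2⟩
        · intro a ha
          rw [testBit_one_shl] at ha
          subst ha
          exact ⟨hr0, hx0⟩
      refine ih _ _ ?_ ?_ i hi
      · intro j hj
        rw [testBit_diff, Bool.and_eq_true] at hj
        exact hR j hj.1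
      · intro j hj
        cases hc : compOK s nd Sb h big M with
        | false => rw [hc, cond_false] at hj; exact hT j hj
        | true =>
          rw [hc, cond_true, Nat.testBit_or, Bool.or_eq_true] at hj
          rcases hj with hj | hj
          · exact hT j hj
          · refine ⟨(hR j (hMQ j hj).1).1, fun hjC => ?_⟩
            have he := hC0.eq hC (hMQ j hj).2 hjC
            have := hok M (fun i hi => (hR i (hMQ i hi).1).1)
              (fun i hi => he ▸ (hMQ i hi).2) j hj
            rw [hc] at this
            exact Bool.noConfusion this

theorem compOK_false (hr : Real G φ s) {S D C : Finset V} {nd Sb : Nat} {big : Bool}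
    (hC : IsComp G S C) (he : ExcOn G C) (hun : ∀ c ∈ C, ¬ Dom G D c)
    (hS : ∀ i < s.n, Sb.testBit i = true → φ i ∈ S)
    (hnd : ∀ i < s.n, nd.testBit i = true → Dom G D (φ i))
    (hbig : big = true → C.card ≤ h)
    (M : Nat) (hM : ∀ i, M.testBit i = true → i < s.n)
    (hMC : ∀ i, M.testBit i = true → φ i ∈ C) (j : Nat) (hj : M.testBit j = true) :
    compOK s nd Sb h big M = false := by
  have hMn := lt_of_bits hM
  have hcard := card_img hMn hr.hn hr.inj
  have hsub : img φ M ⊆ C := by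
    intro v hv
    obtain ⟨i, hi, rfl⟩ := (mem_img hMn hr.hn).1 hv
    exact hMC i hi
  have hle := Finset.card_le_card hsub
  have hec := he.card
  rw [← Bool.not_eq_true, compOK]
  simp only [Bool.or_eq_true, Bool.and_eq_true, Bool.not_eq_true', ← Bool.not_eq_true, beq_iff,
    Nat.ble_eq]
  rintro (h1 | h1 | ⟨hb, h1⟩ | ⟨h1, h2, h3⟩)
  · apply h1
    apply Nat.eq_of_testBit_eq
    intro i
    rw [Nat.zero_testBit, ← Bool.not_eq_true, Nat.testBit_and, Bool.and_eq_true]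
    rintro ⟨a, b⟩
    exact hun _ (hMC i a) (hnd i (hM i a) b)
  · omega
  · have := hbig hb
    omega
  · have : img φ M = C := by
      apply hC.cc.2 _ hsub ⟨φ j, (mem_img hMn hr.hn).2 ⟨j, hj, rfl⟩⟩
      intro a ha b hb hab
      obtain ⟨i, hi, rfl⟩ := (mem_img hMn hr.hn).1 ha
      obtain ⟨k, hk, rfl⟩ := hr.z i (hM i hi) (sub_bit h1 hi) b hab
      have hp := hr.p i (hM i hi) k hk hab
      have hn := hr.hn
      have := sub_bit h3 (i := k) (by
        rw [Nat.testBit_and, Bool.and_eq_true, rows_bit, full_bit]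
        exact ⟨⟨i, (bits_mem 32 M (lt_pow32 hMn hr.hn) i).2 hi, by omega, hp⟩, hk⟩)
      rw [Nat.testBit_or, Bool.or_eq_true] at this
      rcases this with hk' | hk'
      · exact (mem_img hMn hr.hn).2 ⟨k, hk', rfl⟩
      · exact absurd (hS k hk hk') (hC.disj _ hb)
    rw [this] at hcard
    omega

theorem redOK_sound (hx : Ctx G Δ h) (hr : Real G φ s) (D S : Nat)
    (hok : redOK Δ h s D S = true) : False := by
  simp only [redOK, fc_eq, Bool.and_eq_true] at hok
  obtain ⟨hDS, hSK, hS0, hL, hcount⟩ := hok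
  have hn := hr.hn
  have hSn := lt_of_sub_full hSK
  have hDb : ∀ i, D.testBit i = true → S.testBit i = true := fun i hi => sub_bit hDS hi
  have hDn : D < 2 ^ s.n := lt_of_bits (fun i hi => lt_of_bit hSn (hDb i hi))
  set nd := D ||| (rows s.A (bits 32 D) &&& full s.n) with hnd
  have hndb : ∀ i < s.n, nd.testBit i = true → Dom G (img φ D) (φ i) := by
    intro i hi hb
    rw [hnd, Nat.testBit_or, Bool.or_eq_true, Nat.testBit_and, Bool.and_eq_true, rows_bit] at hb
    rcases hb with hb | ⟨⟨j, hj, _, hji⟩, _⟩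
    · exact Or.inl ((mem_img hDn hn).2 ⟨i, hb, rfl⟩)
    · rw [bits_mem 32 D (lt_pow32 hDn hn)] at hj
      exact Or.inr ⟨φ j, (mem_img hDn hn).2 ⟨j, hj, rfl⟩, hr.a j (lt_of_bit hDn hj) i hi hji⟩
  have hndf : ∀ i < s.n, ¬ Dom G (img φ D) (φ i) → nd.testBit i = false := by
    intro i hi hd
    rw [← Bool.not_eq_true]
    exact fun hb => hd (hndb i hi hb)
  have hmS : ∀ i < s.n, (φ i ∈ img φ S ↔ S.testBit i = true) := by
    intro i hi
    rw [mem_img hSn hn]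
    constructor
    · rintro ⟨j, hj, hji⟩
      rw [← hr.inj j (lt_of_bit hSn hj) i hi hji]; exact hj
    · intro h; exact ⟨i, h, rfl⟩
  rw [List.all_eq_true] at hL
  have hLu : ∀ u, S.testBit u = true → ¬ Dom G (img φ D) (φ u) → s.Z.testBit u = true ∧
      sub (diff (rowK s.P s.n u) nd) S = true ∧ le1 (diff (rowK s.P s.n u) nd) = true := by
    intro u hu hd
    have := hL u (by
      rw [bits_mem 32 _ (lt_pow32 (diff_lt nd hSn) hn), testBit_diff, hu,
        hndf u (lt_of_bit hSn hu) hd]; rfl)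
    simp only [Bool.and_eq_true] at this
    exact this
  set T := tset s nd S h (isBig s Δ D S) 32 (diff (full s.n) S) 0 with hT
  have hTb : ∀ C, IsComp G (img φ S) C → ExcOn G C → (∀ c ∈ C, ¬ Dom G (img φ D) c) →
      ∀ i, T.testBit i = true → i < s.n ∧ φ i ∉ C := by
    intro C hC he hun
    apply tset_sound hr hC (fun i hi h => (hmS i hi).1 h)
    · apply compOK_false hr hC he hun (fun i hi h => (hmS i hi).2 h) hndb
      intro hb
      simp only [isBig, Bool.and_eq_true, beq_iff] at hb
      obtain ⟨b1, b2, b3, b4⟩ := hb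
      set c := Nat.log2 D
      have hcD : D.testBit c = true := by rw [b2, testBit_one_shl]
      have hcn := lt_of_bit hDn hcD
      have hNn := rowK_lt s.A s.n c
      have hN3 : (img φ (rowK s.A s.n c)).card = 3 := by
        rw [card_img hNn hn hr.inj, b3]
      have hNa : ∀ w ∈ img φ (rowK s.A s.n c), G.Adj (φ c) w := by
        intro w hw
        obtain ⟨i, hi, rfl⟩ := (mem_img hNn hn).1 hw
        rw [rowK_bit hn] at hi
        exact hr.a c hcn i hi.1 hi.2
      apply hx.big b1 (φ c) (img φ (rowK s.A s.n c)) (img φ S) C hN3 _ _ hC he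
      · intro w
        refine ⟨hNa w, fun hw => ?_⟩
        by_contra hwn
        have := hx.deg (φ c) (insert w (img φ (rowK s.A s.n c))) (by
          intro x hx
          rcases Finset.mem_insert.1 hx with rfl | hx
          · exact hw
          · exact hNa x hx)
        rw [Finset.card_insert_of_notMem hwn] at this
        omega
      · intro w
        rw [mem_img hSn hn, mem_img hNn hn]
        constructor
        · rintro ⟨i, hi, rfl⟩
          rw [b4, Nat.testBit_or, Bool.or_eq_true] at hi
          rcases hi with hi | hi
          · left
            rw [b2, testBit_one_shl] at hi
            rw [hi]
          · exact Or.inr ⟨i, hi, rfl⟩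
        · rintro (rfl | ⟨i, hi, rfl⟩)
          · exact ⟨c, hDb c hcD, rfl⟩
          · refine ⟨i, ?_, rfl⟩
            rw [b4, Nat.testBit_or, hi, Bool.or_true]
    · intro i hi
      rw [testBit_diff, Bool.and_eq_true, full_bit] at hi
      refine ⟨hi.1, fun h => ?_⟩
      rw [hmS i hi.1] at h
      simp [h] at hi
    · intro i hi
      simp at hi
  -- apply the reduction lemma
  have hsd : img φ S \ img φ D = img φ (diff S D) := by
    ext v
    rw [Finset.mem_sdiff, mem_img hSn hn, mem_img hDn hn, mem_img (diff_lt D hSn) hn]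
    constructor
    · rintro ⟨⟨i, hi, rfl⟩, h2⟩
      refine ⟨i, ?_, rfl⟩
      rw [testBit_diff, hi]
      cases hd : D.testBit i with
      | true => exact absurd ⟨i, hd, rfl⟩ h2
      | false => rfl
    · rintro ⟨i, hi, rfl⟩
      rw [testBit_diff, Bool.and_eq_true] at hi
      refine ⟨⟨i, hi.1, rfl⟩, ?_⟩
      rintro ⟨j, hj, hji⟩
      have := hr.inj j (lt_of_bit hDn hj) i (lt_of_bit hSn hi.1) hji
      subst this
      simp [hj] at hi
  -- the set of vertices excluded
  set TT : Finset V := Finset.univ.filter (fun v => ∃ i, i < s.n ∧ T.testBit i = true ∧ φ i = v)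
    with hTT
  have hmT : ∀ v, v ∈ TT ↔ ∃ i, i < s.n ∧ T.testBit i = true ∧ φ i = v := by
    intro v; simp [hTT]
  refine reduce excFacts hx.min (img φ S) (img φ D) TT ?_ ?_ ?_ ?_ ?_ ?_
  · have h0 : S ≠ 0 := by
      rintro rfl
      simp [Nat.beq] at hS0
    exact ⟨φ (Nat.log2 S), (mem_img hSn hn).2 ⟨_, Nat.testBit_log2 h0, rfl⟩⟩
  · intro v hv
    obtain ⟨i, hi, rfl⟩ := (mem_img hDn hn).1 hv
    exact (mem_img hSn hn).2 ⟨i, hDb i hi, rfl⟩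
  · intro a ha hda w haw hdw
    obtain ⟨u, hu, rfl⟩ := (mem_img hSn hn).1 ha
    obtain ⟨hz, hs, _⟩ := hLu u hu hda
    obtain ⟨j, hj, rfl⟩ := hr.z u (lt_of_bit hSn hu) hz w haw
    rw [hmS j hj]
    apply sub_bit hs
    rw [testBit_diff, hndf j hj hdw,
      (rowK_bit hn).2 ⟨hj, hr.p u (lt_of_bit hSn hu) j hj haw⟩]
    rfl
  · intro b hb hdb a c hba hbc hda hdc
    obtain ⟨u, hu, rfl⟩ := (mem_img hSn hn).1 hb
    obtain ⟨hz, _, hl⟩ := hLu u hu hdb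
    obtain ⟨j, hj, rfl⟩ := hr.z u (lt_of_bit hSn hu) hz a hba
    obtain ⟨k, hk, rfl⟩ := hr.z u (lt_of_bit hSn hu) hz c hbc
    rw [le1_eq hl (i := j) (j := k)]
    · rw [testBit_diff, hndf j hj hda,
        (rowK_bit hn).2 ⟨hj, hr.p u (lt_of_bit hSn hu) j hj hba⟩]
      rfl
    · rw [testBit_diff, hndf k hk hdc,
        (rowK_bit hn).2 ⟨hk, hr.p u (lt_of_bit hSn hu) k hk hbc⟩]
      rfl
  · intro C hC he hun c hc hcT
    obtain ⟨i, hi, hiT, rfl⟩ := (hmT c).1 hcT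
    exact (hTb C hC he hun i hiT).2 hc
  · rw [Nat.ble_eq] at hcount
    rw [hsd, sum_img (diff_lt D hSn) hn hr.inj, card_img hDn hn hr.inj, card_img hSn hn hr.inj]
    refine le_trans (Nat.add_le_add_left ?_ _) hcount
    apply List.sum_le_sum
    intro i hi
    rw [bits_mem 32 _ (lt_pow32 (diff_lt D hSn) hn), testBit_diff, Bool.and_eq_true] at hi
    have hin := lt_of_bit hSn hi.1
    rw [eterm]
    cases hz : s.Z.testBit i with
    | true =>
      rw [cond_true]
      have hl := diff_lt (S ||| T) (rowK_lt s.P s.n i)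
      rw [← card_img hl hn hr.inj]
      apply Finset.card_le_card
      intro w hw
      simp only [Finset.mem_filter, Finset.mem_univ, true_and] at hw
      obtain ⟨hw1, hw2, hw3⟩ := hw
      obtain ⟨j, hj, rfl⟩ := hr.z i hin hz w hw1
      refine (mem_img hl hn).2 ⟨j, ?_, rfl⟩
      rw [hmS j hj] at hw2
      have h3 : T.testBit j = false := by
        rw [← Bool.not_eq_true]
        exact fun h => hw3 ((hmT _).2 ⟨j, hj, h, rfl⟩)
      rw [testBit_diff, Nat.testBit_or, (rowK_bit hn).2 ⟨hj, hr.p i hin j hj hw1⟩, h3]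
      simp [hw2]
    | false =>
      rw [cond_false]
      have hl : rowK s.A s.n i &&& (S ||| T) < 2 ^ s.n :=
        lt_of_le_of_lt Nat.and_le_left (rowK_lt s.A s.n i)
      rw [← card_img hl hn hr.inj]
      have hd : Disjoint (img φ (rowK s.A s.n i &&& (S ||| T))) (Finset.univ.filter
          (fun w => G.Adj (φ i) w ∧ w ∉ img φ S ∧ w ∉ TT)) := by
        rw [Finset.disjoint_left]
        intro w hw hw'
        simp only [Finset.mem_filter, Finset.mem_univ, true_and] at hw'
        obtain ⟨j, hj, rfl⟩ := (mem_img hl hn).1 hw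
        rw [Nat.testBit_and, Bool.and_eq_true, rowK_bit hn, Nat.testBit_or,
          Bool.or_eq_true] at hj
        obtain ⟨⟨hjn, _⟩, hj | hj⟩ := hj
        · exact hw'.2.1 ((hmS j hjn).2 hj)
        · exact hw'.2.2 ((hmT _).2 ⟨j, hjn, hj, rfl⟩)
      have := hx.deg (φ i) (img φ (rowK s.A s.n i &&& (S ||| T)) ∪ Finset.univ.filter
          (fun w => G.Adj (φ i) w ∧ w ∉ img φ S ∧ w ∉ TT)) (by
        intro w hw
        rcases Finset.mem_union.1 hw with hw | hw
        · obtain ⟨j, hj, rfl⟩ := (mem_img hl hn).1 hw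
          rw [Nat.testBit_and, Bool.and_eq_true, rowK_bit hn] at hj
          exact hr.a i hin j hj.1.1 hj.1.2
        · simp only [Finset.mem_filter, Finset.mem_univ, true_and] at hw
          exact hw.1)
      rw [Finset.card_union_of_disjoint hd] at this
      omega

end sound

/-! ## Part 6: operations on partial descriptions and certificates -/

def sh (i j : Nat) : Nat := 1 <<< (32 * i + j)

/-- One bit in each of the 32 rows, in column 0. -/
def col0 : Nat := rows32 32
where
  rows32 : Nat → Nat
    | 0 => 0
    | k + 1 => rows32 k ||| (1 <<< (32 * k))

/-- All pairs with a member `i`. -/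
def rc (i : Nat) : Nat := (4294967295 <<< (32 * i)) ||| (col0 <<< i)

theorem tb_sh {i j a b : Nat} (hj : j < 32) (hb : b < 32) :
    tb (sh i j) a b = true ↔ a = i ∧ b = j := by
  rw [tb, sh, testBit_one_shl]
  omega

theorem tb_rc : ∀ i < 32, ∀ a < 32, ∀ b < 32, tb (rc i) a b = (Nat.beq a i || Nat.beq b i) := by
  decide +kernel

def finish (Δ i : Nat) (s : St) : St :=
  norm s fun s => bif Nat.beq (pc (rowK s.A s.n i)) Δ
    then ⟨s.n, s.A, diff s.P (diff (rc i) s.A), s.Z ||| (1 <<< i)⟩ else s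

def setAdj (Δ i j : Nat) (s : St) : St :=
  finish Δ j (finish Δ i ⟨s.n, s.A ||| (sh i j ||| sh j i), s.P, s.Z⟩)

def setNon (i j : Nat) (s : St) : St := ⟨s.n, s.A, diff s.P (sh i j ||| sh j i), s.Z⟩

def close (i : Nat) (s : St) : St := ⟨s.n, s.A, s.P, s.Z ||| (1 <<< i)⟩

def nonMask (n : Nat) : List Nat → Nat
  | [] => sh n n
  | j :: l => (sh n j ||| sh j n) ||| nonMask n l

def growVert (s : St) : St :=
  ⟨s.n + 1, diff s.A (rc s.n), diff (s.P ||| rc s.n) (nonMask s.n (bits 32 (s.Z &&& full s.n))),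
    s.Z &&& full s.n⟩

/-- Continue with `f` after adding the edge `i j`, unless this edge is impossible. -/
def adjStep (Δ i j : Nat) (s : St) (f : St → Bool) : Bool :=
  bif tb s.P i j && tb s.P j i then norm (setAdj Δ i j s) f else true

/-- Certificates. -/
inductive Cert where
  | V : Cert
  | R (D S : Nat) : Cert
  | H (a b c d e f : Nat) : Cert
  | I (k : Nat) (q : List Nat) : Cert
  | A (i j : Nat) (y n : Cert) : Cert
  | N (i : Nat) (c n : Cert) : Cert

def c6OK (s : St) (q : List Nat) : Bool :=
  allLt 6 fun i => Nat.blt (q.getD i 0) s.n && allLt 6 fun j =>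
    bif Nat.beq i j then true else
    !(Nat.beq (q.getD i 0) (q.getD j 0)) &&
    (bif Nat.beq ((i + 1) % 6) j || Nat.beq ((j + 1) % 6) i
      then tb s.A (q.getD i 0) (q.getD j 0) else !(tb s.P (q.getD i 0) (q.getD j 0)))

def isoOK (s : St) (e : Nat × Nat) (q : List Nat) : Bool :=
  sub (full s.n) s.Z && (!(Nat.beq s.n 0) &&
  (allLt s.n (fun j => !(allLt e.1 fun i => !(Nat.beq (q.getD i 0) j))) &&
  allLt e.1 fun i => Nat.blt (q.getD i 0) s.n && allLt e.1 fun j =>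
    bif Nat.beq i j then !(tb e.2 i j) else
    !(Nat.beq (q.getD i 0) (q.getD j 0)) &&
    (bif tb e.2 i j
      then tb s.A (q.getD i 0) (q.getD j 0) else !(tb s.P (q.getD i 0) (q.getD j 0)))))

def check (Δ h : Nat) : Cert → St → Bool
  | .V, _ => false
  | .R D S, s => redOK Δ h s D S
  | .H a b c d e f, s => c6OK s [a, b, c, d, e, f]
  | .I k q, s => Nat.blt k excs.length && isoOK s (excs.getD k (0, 0)) q
  | .A i j y n, s => Nat.blt i s.n && (Nat.blt j s.n &&
      (adjStep Δ i j s (check Δ h y) && norm (setNon i j s) (check Δ h n)))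
  | .N i c n, s => Nat.blt i s.n && (Nat.blt s.n 32 &&
      (norm (close i s) (check Δ h c) && norm (growVert s) fun s' =>
        adjStep Δ i s.n s' (check Δ h n)))

section sound
open scoped Classical
variable {V : Type u} [Fintype V] {G : SimpleGraph V} {φ : Nat → V} {Δ h : Nat} {s : St}

theorem all_nbrs (hx : Ctx G Δ h) (hr : Real G φ s) {i : Nat} (hi : i < s.n)
    (hpc : pc (rowK s.A s.n i) = Δ) (w : V) (hw : G.Adj (φ i) w) :
    ∃ j < s.n, tb s.A i j = true ∧ φ j = w := by
  have hn := hr.hn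
  have hl := rowK_lt s.A s.n i
  by_contra hno
  have hwn : w ∉ img φ (rowK s.A s.n i) := by
    intro hw'
    obtain ⟨j, hj, hjw⟩ := (mem_img hl hn).1 hw'
    rw [rowK_bit hn] at hj
    exact hno ⟨j, hj.1, hj.2, hjw⟩
  have := hx.deg (φ i) (insert w (img φ (rowK s.A s.n i))) (by
    intro x hx
    rcases Finset.mem_insert.1 hx with rfl | hx
    · exact hw
    · obtain ⟨j, hj, rfl⟩ := (mem_img hl hn).1 hx
      rw [rowK_bit hn] at hj
      exact hr.a i hi j hj.1 hj.2)
  rw [Finset.card_insert_of_notMem hwn, card_img hl hn hr.inj] at this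
  omega

theorem finish_n {i : Nat} : (finish Δ i s).n = s.n := by
  rw [finish, norm_eq]
  cases Nat.beq (pc (rowK s.A s.n i)) Δ <;> rfl

theorem finish_real (hx : Ctx G Δ h) {i : Nat} (hi : i < s.n) (hr : Real G φ s) :
    Real G φ (finish Δ i s) := by
  rw [finish, norm_eq]
  cases hb : Nat.beq (pc (rowK s.A s.n i)) Δ with
  | false => rw [cond_false]; exact hr
  | true =>
    rw [cond_true]
    rw [beq_iff] at hb
    have hall := all_nbrs hx hr hi hb
    have hn := hr.hn
    refine ⟨hr.hn, hr.inj, hr.a, hr.sym, ?_, ?_⟩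
    · intro a ha b hbn hab
      change a < s.n at ha
      change b < s.n at hbn
      have hp := hr.p a ha b hbn hab
      change tb (diff s.P (diff (rc i) s.A)) a b = true
      rw [tb_diff, tb_diff, hp, tb_rc i (by omega) a (by omega) b (by omega)]
      by_cases h1 : a = i
      · subst h1
        obtain ⟨j, hj, hjA, hjb⟩ := hall _ hab
        rw [← hr.inj j hj b hbn hjb, hjA]
        simp
      · by_cases h2 : b = i
        · subst h2
          obtain ⟨j, hj, hjA, hjb⟩ := hall _ hab.symm
          have := hr.inj j hj a ha hjb
          subst this
          rw [hr.sym b hbn j hj hjA]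
          simp
        · have e1 : Nat.beq a i = false := by rw [← Bool.not_eq_true, beq_iff]; exact h1
          have e2 : Nat.beq b i = false := by rw [← Bool.not_eq_true, beq_iff]; exact h2
          rw [e1, e2]
          simp
    · intro a ha hz w haw
      change (s.Z ||| (1 <<< i)).testBit a = true at hz
      rw [Nat.testBit_or, Bool.or_eq_true, testBit_one_shl] at hz
      rcases hz with hz | rfl
      · exact hr.z a ha hz w haw
      · obtain ⟨j, hj, _, hjw⟩ := hall w haw
        exact ⟨j, hj, hjw⟩

theorem setAdj_real (hx : Ctx G Δ h) {i j : Nat} (hi : i < s.n) (hj : j < s.n)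
    (hr : Real G φ s) (hij : G.Adj (φ i) (φ j)) : Real G φ (setAdj Δ i j s) := by
  have hn := hr.hn
  rw [setAdj]
  have key : ∀ a < s.n, ∀ b < s.n, tb (s.A ||| (sh i j ||| sh j i)) a b = true ↔
      (tb s.A a b = true ∨ (a = i ∧ b = j) ∨ (a = j ∧ b = i)) := by
    intro a ha b hb
    rw [tb_or, tb_or, Bool.or_eq_true, Bool.or_eq_true, tb_sh (by omega) (by omega),
      tb_sh (by omega) (by omega)]
  apply finish_real hx (by rw [finish_n]; exact hj)
  refine finish_real hx hi ⟨hr.hn, hr.inj, ?_, ?_, hr.p, hr.z⟩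
  · intro a ha b hb hab
    rcases (key a ha b hb).1 hab with h | ⟨rfl, rfl⟩ | ⟨rfl, rfl⟩
    · exact hr.a a ha b hb h
    · exact hij
    · exact hij.symm
  · intro a ha b hb hab
    apply (key b hb a ha).2
    rcases (key a ha b hb).1 hab with h | ⟨rfl, rfl⟩ | ⟨rfl, rfl⟩
    · exact Or.inl (hr.sym a ha b hb h)
    · simp
    · simp

theorem adjStep_sound (hx : Ctx G Δ h) {i j : Nat} (hi : i < s.n) (hj : j < s.n)
    (hr : Real G φ s) (hij : G.Adj (φ i) (φ j)) {f : St → Bool}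
    (hf : adjStep Δ i j s f = true) : ∃ s', Real G φ s' ∧ f s' = true ∧ s'.n = s.n := by
  rw [adjStep, hr.p i hi j hj hij, hr.p j hj i hi hij.symm, Bool.and_self, cond_true, norm_eq] at hf
  exact ⟨_, setAdj_real hx hi hj hr hij, hf, by rw [setAdj, finish_n, finish_n]⟩

theorem setNon_real {i j : Nat} (hi : i < s.n) (hj : j < s.n)
    (hr : Real G φ s) (hij : ¬ G.Adj (φ i) (φ j)) : Real G φ (setNon i j s) := by
  have hn := hr.hn
  refine ⟨hr.hn, hr.inj, hr.a, hr.sym, ?_, hr.z⟩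
  intro a ha b hb hab
  change a < s.n at ha
  change b < s.n at hb
  change tb (diff s.P (sh i j ||| sh j i)) a b = true
  rw [tb_diff, hr.p a ha b hb hab, Bool.true_and, Bool.not_eq_true', ← Bool.not_eq_true, tb_or,
    Bool.or_eq_true, tb_sh (by omega) (by omega), tb_sh (by omega) (by omega)]
  rintro (⟨rfl, rfl⟩ | ⟨rfl, rfl⟩)
  · exact hij hab
  · exact hij hab.symm

theorem close_real {i : Nat} (hr : Real G φ s)
    (hc : ∀ w, G.Adj (φ i) w → ∃ j < s.n, φ j = w) : Real G φ (close i s) := by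
  refine ⟨hr.hn, hr.inj, hr.a, hr.sym, hr.p, ?_⟩
  intro a ha hz w haw
  change (s.Z ||| (1 <<< i)).testBit a = true at hz
  rw [Nat.testBit_or, Bool.or_eq_true, testBit_one_shl] at hz
  rcases hz with hz | rfl
  · exact hr.z a ha hz w haw
  · exact hc w haw

theorem nonMask_bit {n a b : Nat} (hn : n < 32) (hb : b < 32) : ∀ l : List Nat, (∀ j ∈ l, j < 32) →
    tb (nonMask n l) a b = true → (a = n ∧ b = n) ∨ (a = n ∧ b ∈ l) ∨ (b = n ∧ a ∈ l) := by
  intro l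
  induction l with
  | nil =>
    intro _ h
    rw [nonMask, tb_sh hn hb] at h
    exact Or.inl h
  | cons j l ih =>
    intro hl h
    rw [nonMask, tb_or, tb_or, Bool.or_eq_true, Bool.or_eq_true,
      tb_sh (hl j (by simp)) hb, tb_sh hn hb] at h
    rcases h with (⟨rfl, rfl⟩ | ⟨rfl, rfl⟩) | h
    · simp
    · simp
    · rcases ih (fun j hj => hl j (by simp [hj])) h with h | h | h
      · exact Or.inl h
      · exact Or.inr (Or.inl ⟨h.1, by simp [h.2]⟩)
      · exact Or.inr (Or.inr ⟨h.1, by simp [h.2]⟩)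

theorem growVert_real (hr : Real G φ s) (hn : s.n < 32) (w : V) (hw : ¬ ∃ j < s.n, φ j = w) :
    Real G (Function.update φ s.n w) (growVert s) := by
  have hold : ∀ i, i < s.n → Function.update φ s.n w i = φ i := by
    intro i hi
    rw [Function.update_of_ne]
    omega
  have hnew : Function.update φ s.n w s.n = w := Function.update_self _ _ _
  have hcase : ∀ i, i < s.n + 1 → i < s.n ∨ i = s.n := by omega
  have hZn := and_full_lt s.Z s.n
  have hZ32 := lt_pow32 hZn hr.hn
  have hA : ∀ a < s.n + 1, ∀ b < s.n + 1, tb (diff s.A (rc s.n)) a b = true →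
      a < s.n ∧ b < s.n ∧ tb s.A a b = true := by
    intro a ha b hb h
    rw [tb_diff, Bool.and_eq_true, tb_rc s.n hn a (by omega) b (by omega), Bool.not_eq_true',
      ← Bool.not_eq_true, Bool.or_eq_true, beq_iff, beq_iff] at h
    have := h.2
    exact ⟨by omega, by omega, h.1⟩
  refine ⟨hn, ?_, ?_, ?_, ?_, ?_⟩
  · intro i hi j hj hij
    change i < s.n + 1 at hi
    change j < s.n + 1 at hj
    rcases hcase i hi with h1 | rfl <;> rcases hcase j hj with h2 | rfl
    · rw [hold i h1, hold j h2] at hij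
      exact hr.inj i h1 j h2 hij
    · rw [hold i h1, hnew] at hij
      exact absurd ⟨i, h1, hij⟩ hw
    · rw [hold j h2, hnew] at hij
      exact absurd ⟨j, h2, hij.symm⟩ hw
    · rfl
  · intro i hi j hj hij
    obtain ⟨h1, h2, h3⟩ := hA i hi j hj hij
    rw [hold i h1, hold j h2]
    exact hr.a i h1 j h2 h3
  · intro i hi j hj hij
    obtain ⟨h1, h2, h3⟩ := hA i hi j hj hij
    change tb (diff s.A (rc s.n)) j i = true
    rw [tb_diff, hr.sym i h1 j h2 h3, tb_rc s.n hn j (by omega) i (by omega), Bool.true_and,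
      Bool.not_eq_true', ← Bool.not_eq_true, Bool.or_eq_true, beq_iff, beq_iff]
    omega
  · intro i hi j hj hij
    change i < s.n + 1 at hi
    change j < s.n + 1 at hj
    change tb (diff (s.P ||| rc s.n) (nonMask s.n (bits 32 (s.Z &&& full s.n)))) i j = true
    have hP : tb (s.P ||| rc s.n) i j = true := by
      rw [tb_or, Bool.or_eq_true, tb_rc s.n hn i (by omega) j (by omega), Bool.or_eq_true, beq_iff,
        beq_iff]
      rcases hcase i hi with h1 | h1
      · rcases hcase j hj with h2 | h2
        · left
          rw [hold i h1, hold j h2] at hij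
          exact hr.p i h1 j h2 hij
        · simp [h2]
      · simp [h1]
    have hZm : ∀ k, k ∈ bits 32 (s.Z &&& full s.n) → k < s.n ∧ ¬ G.Adj (φ k) w := by
      intro k hk
      rw [bits_mem 32 _ hZ32, Nat.testBit_and, Bool.and_eq_true, full_bit] at hk
      exact ⟨hk.2, fun h => hw (hr.z k hk.2 hk.1 w h)⟩
    rw [tb_diff, hP, Bool.true_and, Bool.not_eq_true', ← Bool.not_eq_true]
    intro hm
    rcases nonMask_bit hn (by omega) _ (fun k hk => by have := (hZm k hk).1; omega) hm with
      ⟨rfl, rfl⟩ | ⟨rfl, h2⟩ | ⟨rfl, h2⟩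
    · exact G.loopless.irrefl _ hij
    · rw [hold j (hZm j h2).1, hnew] at hij
      exact (hZm j h2).2 hij.symm
    · rw [hold i (hZm i h2).1, hnew] at hij
      exact (hZm i h2).2 hij
  · intro i hi hz x hix
    change (s.Z &&& full s.n).testBit i = true at hz
    rw [Nat.testBit_and, Bool.and_eq_true, full_bit] at hz
    rw [hold i hz.2] at hix
    obtain ⟨j, hj, hjx⟩ := hr.z i hz.2 hz.1 x hix
    exact ⟨j, Nat.lt_succ_of_lt hj, by rw [hold j hj]; exact hjx⟩

theorem cyc6 : ∀ i j : Fin 6, (SimpleGraph.cycleGraph 6).Adj i j ↔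
    (i ≠ j ∧ (Nat.beq ((i.val + 1) % 6) j.val || Nat.beq ((j.val + 1) % 6) i.val) = true) := by
  decide

theorem blt_iff (a b : Nat) : Nat.blt a b = true ↔ a < b := by
  rw [Nat.blt, Nat.ble_eq]
  exact Iff.rfl

theorem c6OK_sound (hx : Ctx G Δ h) (hr : Real G φ s) (q : List Nat)
    (hok : c6OK s q = true) : False := by
  simp only [c6OK, allLt_iff, Bool.and_eq_true, blt_iff] at hok
  apply hx.min.noc6
  have hlt : ∀ i : Fin 6, q.getD i.val 0 < s.n := fun i => (hok i.val i.isLt).1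
  have hpair : ∀ i j : Fin 6, i ≠ j → q.getD i.val 0 ≠ q.getD j.val 0 ∧
    (bif Nat.beq ((i.val + 1) % 6) j.val || Nat.beq ((j.val + 1) % 6) i.val
      then tb s.A (q.getD i.val 0) (q.getD j.val 0)
      else !(tb s.P (q.getD i.val 0) (q.getD j.val 0))) = true := by
    intro i j hij
    have := (hok i.val i.isLt).2 j.val j.isLt
    have hb : Nat.beq i.val j.val = false := by
      rw [← Bool.not_eq_true, beq_iff]
      exact fun h => hij (Fin.ext h)
    rw [hb, cond_false, Bool.and_eq_true, Bool.not_eq_true', ← Bool.not_eq_true, beq_iff] at this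
    exact this
  refine ⟨fun i => φ (q.getD i.val 0), ?_, ?_⟩
  · intro i j hij
    by_contra hne
    exact (hpair i j hne).1 (hr.inj _ (hlt i) _ (hlt j) hij)
  · intro i j
    rw [cyc6]
    by_cases hij : i = j
    · subst hij
      simp
    · obtain ⟨_, h2⟩ := hpair i j hij
      cases hc : (Nat.beq ((i.val + 1) % 6) j.val || Nat.beq ((j.val + 1) % 6) i.val) with
      | true =>
        rw [hc, cond_true] at h2
        have := hr.a _ (hlt i) _ (hlt j) h2
        exact ⟨fun _ => ⟨hij, rfl⟩, fun _ => this⟩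
      | false =>
        rw [hc, cond_false, Bool.not_eq_true', ← Bool.not_eq_true] at h2
        have : ¬ G.Adj (φ (q.getD i.val 0)) (φ (q.getD j.val 0)) :=
          fun h => h2 (hr.p _ (hlt i) _ (hlt j) h)
        exact ⟨fun h => absurd h this, fun h => Bool.noConfusion h.2⟩

theorem isoOK_sound (hx : Ctx G Δ h) (hr : Real G φ s) (e : Nat × Nat) (he : e ∈ excs)
    (q : List Nat) (hok : isoOK s e q = true) : False := by
  simp only [isoOK, allLt_iff, Bool.and_eq_true, blt_iff, Bool.not_eq_true', ← Bool.not_eq_true,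
    beq_iff] at hok
  obtain ⟨hZ, h0, hsurj, hq⟩ := hok
  apply hx.min.nexc
  refine ⟨e, he, fun i => φ (q.getD i 0), fun i _ => Finset.mem_univ _, ?_, ?_, ?_⟩
  · intro i hi j hj hij
    by_contra hne
    have := (hq i hi).2 j hj
    have hb : Nat.beq i j = false := by rw [← Bool.not_eq_true, beq_iff]; exact hne
    rw [hb, cond_false, Bool.and_eq_true, Bool.not_eq_true', ← Bool.not_eq_true, beq_iff] at this
    exact this.1 (hr.inj _ (hq i hi).1 _ (hq j hj).1 hij)
  · intro c _
    have hI : (Finset.range s.n).image φ = Finset.univ := by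
      apply hx.min.conn.2 _ (Finset.subset_univ _)
      · exact ⟨φ 0, Finset.mem_image.2 ⟨0, Finset.mem_range.2 (by omega), rfl⟩⟩
      · intro a ha b _ hab
        obtain ⟨i, hi, rfl⟩ := Finset.mem_image.1 ha
        rw [Finset.mem_range] at hi
        obtain ⟨j, hj, rfl⟩ := hr.z i hi (sub_bit hZ ((full_bit _ _).2 hi)) b hab
        exact Finset.mem_image.2 ⟨j, Finset.mem_range.2 hj, rfl⟩
    have hc : c ∈ (Finset.range s.n).image φ := by rw [hI]; exact Finset.mem_univ _
    obtain ⟨j, hj, rfl⟩ := Finset.mem_image.1 hc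
    have := hsurj j (Finset.mem_range.1 hj)
    by_contra hno
    apply this
    intro i hi hij
    exact hno ⟨i, hi, by rw [hij]⟩
  · intro i hi j hj
    have := (hq i hi).2 j hj
    by_cases hij : i = j
    · subst hij
      rw [(beq_iff i i).2 rfl, cond_true] at this
      simp only [Bool.not_eq_true'] at this
      simp [this]
    · have hb : Nat.beq i j = false := by rw [← Bool.not_eq_true, beq_iff]; exact hij
      rw [hb, cond_false, Bool.and_eq_true] at this
      have h2 := this.2
      cases hc : tb e.2 i j with
      | true =>
        rw [hc, cond_true] at h2
        exact ⟨fun _ => rfl, fun _ => hr.a _ (hq i hi).1 _ (hq j hj).1 h2⟩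
      | false =>
        rw [hc, cond_false, Bool.not_eq_true', ← Bool.not_eq_true] at h2
        have : ¬ G.Adj (φ (q.getD i 0)) (φ (q.getD j 0)) :=
          fun h => h2 (hr.p _ (hq i hi).1 _ (hq j hj).1 h)
        simp only [this, Bool.false_eq_true]

theorem check_sound (hx : Ctx G Δ h) (c : Cert) : ∀ (φ : Nat → V) (s : St), Real G φ s →
    check Δ h c s = true → False := by
  induction c with
  | V => intro φ s _ hc; exact Bool.noConfusion hc
  | R D S => intro φ s hr hc; exact redOK_sound hx hr D S hc
  | H a b c d e f => intro φ s hr hc; exact c6OK_sound hx hr _ hc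
  | I k q =>
    intro φ s hr hc
    rw [check, Bool.and_eq_true, blt_iff] at hc
    refine isoOK_sound hx hr _ ?_ q hc.2
    rw [List.getD_eq_getElem _ _ hc.1]
    exact List.getElem_mem _
  | A i j y n ihy ihn =>
    intro φ s hr hc
    rw [check] at hc
    simp only [Bool.and_eq_true, blt_iff] at hc
    obtain ⟨hi, hj, hy, hn⟩ := hc
    by_cases hij : G.Adj (φ i) (φ j)
    · obtain ⟨s', hr', hc', _⟩ := adjStep_sound hx hi hj hr hij hy
      exact ihy φ s' hr' hc'
    · rw [norm_eq] at hn
      exact ihn φ _ (setNon_real hi hj hr hij) hn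
  | N i c n ihc ihn =>
    intro φ s hr hcc
    rw [check] at hcc
    simp only [Bool.and_eq_true, blt_iff, norm_eq] at hcc
    obtain ⟨hi, hn32, hc, hn⟩ := hcc
    by_cases hcl : ∀ w, G.Adj (φ i) w → ∃ j < s.n, φ j = w
    · exact ihc φ _ (close_real hr hcl) hc
    · push Not at hcl
      obtain ⟨w, hw, hwn⟩ := hcl
      have hr' := growVert_real hr hn32 w (by
        rintro ⟨j, hj, hjw⟩
        exact hwn j hj hjw)
      have hiw : G.Adj (Function.update φ s.n w i) (Function.update φ s.n w s.n) := by
        rw [Function.update_self, Function.update_of_ne (by omega)]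
        exact hw
      have hni : i < (growVert s).n := Nat.lt_succ_of_lt hi
      have hnn : s.n < (growVert s).n := Nat.lt_succ_self _
      obtain ⟨s', hr'', hc', _⟩ := adjStep_sound hx hni hnn hr' hiw hn
      exact ihn _ s' hr'' hc'

end sound

/-! ## Part 7: the initial descriptions -/

/-- Vertex 0 has the neighbours 1, 2, 3; the vertices from 4 on form an exceptional component. -/
def rootSt (e : Nat × Nat) : St :=
  ⟨4 + e.1, (e.2 <<< 132) ||| ((sh 0 1 ||| sh 1 0) ||| ((sh 0 2 ||| sh 2 0) ||| (sh 0 3 ||| sh 3 0))),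
    diff ((e.2 <<< 132) ||| (rc 1 ||| (rc 2 ||| rc 3))) (sh 1 1 ||| (sh 2 2 ||| sh 3 3)),
    1 ||| (full e.1 <<< 4)⟩

def finAll : Nat → St → St
  | 0, s => s
  | k + 1, s => finAll k (finish 3 k s)

/-- Is the exceptional graph invariant under rotation? -/
def rot (e : Nat × Nat) : Bool :=
  allLt e.1 fun a => allLt e.1 fun i => allLt e.1 fun j =>
    (tb e.2 ((i + a) % e.1) ((j + a) % e.1)).xor (!(tb e.2 i j))

def rootCheck (e : Nat × Nat) (cs : List (List Cert)) : Bool :=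
  norm (finAll (4 + e.1) (rootSt e)) fun s =>
  allLt (bif rot e then 1 else e.1) fun y => adjStep 3 1 (4 + y) s fun s1 =>
  allLt e.1 fun z => adjStep 3 2 (4 + z) s1 (check 3 e.1 ((cs.getD y []).getD z .V))

open Cert in
/-- Certificates for the exceptional component P3. -/
def cert0 : List (List Cert) :=
 [[A 6 3 (A 1 2 (A 3 5 (I 8 [6, 3, 0, 1, 2, 4, 5]) (H 0 1 4 5 6 3)) (A 1 3 (A 5 2 (I 6 [3, 0, 2, 4, 5, 6, 1])
 (A 6 2 (R 4 127) (R 2 123))) (A 1 5 (A 2 3 (I 6 [3, 0, 1, 4, 5, 6, 2]) (A 2 6 (R 4 119)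
 (H 0 2 4 5 6 3))) (A 1 6 (A 5 2 (R 2 119) (A 5 3 (R 2 123) (R 2 114))) (A 2 3 (R 4 125)
 (A 2 5 (H 0 1 4 5 6 3) (A 2 6 (A 5 3 (R 4 125) (R 4 116)) (A 3 5 (N 1 (N 2 (I 7 [6, 3, 0, 1, 2, 4, 5])
 (R 8 105)) (R 8 105)) (H 0 1 4 5 6 3))))))))) (R 16 116),
A 1 2 (A 6 3 (A 4 3 (R 16 127) (R 4 55)) (R 2 119)) (A 1 3 (A 2 3 (R 4 127) (A 2 4 (A 6 3
 (I 6 [3, 0, 2, 4, 5, 6, 1]) (R 4 117)) (A 2 6 (A 3 4 (I 8 [6, 2, 0, 1, 3, 4, 5]) (A 3 6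
 (I 6 [1, 0, 2, 6, 5, 4, 3]) (N 3 (I 4 [1, 0, 2, 6, 5, 4, 3]) (R 4 101)))) (A 3 4 (R 16 122)
 (A 3 6 (N 2 (I 5 [5, 2, 0, 1, 3, 6, 4]) (R 2 27)) (N 2 (N 3 (I 3 [5, 2, 0, 3, 1, 4, 6])
 (R 32 116)) (R 2 27))))))) (A 1 6 (A 2 3 (A 3 4 (R 16 127) (A 3 6 (R 64 127) (N 3 (I 7 [3, 0, 1, 4, 6, 5, 2])
 (R 2 83)))) (A 2 4 (R 2 119) (A 2 6 (R 2 119) (A 3 4 (R 16 120) (A 3 6 (R 64 120) (N 2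
 (R 2 119) (A 3 7 (R 2 83) (N 3 (R 2 91) (R 32 116))))))))) (A 2 3 (R 4 109) (A 2 4 (A 6 3
 (H 0 1 4 5 6 3) (R 4 117)) (A 2 6 (A 3 4 (A 3 6 (R 8 125) (N 1 (N 3 (I 7 [6, 2, 0, 1, 3, 4, 5])
 (R 4 101)) (R 4 101))) (A 3 6 (H 0 1 4 5 6 3) (N 1 (R 4 119) (R 32 116)))) (A 3 4 (R 16 120)
 (A 3 6 (H 0 1 4 5 6 3) (N 1 (R 4 119) (R 32 116))))))))),
A 1 2 (A 5 3 (A 3 4 (I 6 [2, 0, 3, 4, 5, 6, 1]) (A 3 6 (I 6 [1, 0, 3, 6, 5, 4, 2]) (N 3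
 (I 5 [5, 3, 0, 1, 2, 6, 4]) (R 2 23)))) (A 6 3 (A 4 3 (R 8 127) (R 4 119)) (R 2 119)))
 (A 1 3 (A 2 3 (H 0 1 4 5 6 2) (A 2 4 (A 5 3 (R 16 127) (R 4 116)) (A 2 5 (A 3 4 (I 8 [6, 2, 0, 1, 3, 4, 5])
 (A 3 6 (I 6 [1, 0, 2, 6, 5, 4, 3]) (N 3 (I 4 [1, 0, 2, 6, 5, 4, 3]) (R 4 101)))) (H 0 1 4 5 6 2))))
 (A 1 5 (A 2 3 (A 3 4 (I 6 [2, 0, 1, 4, 5, 6, 3]) (A 3 6 (I 8 [4, 1, 0, 2, 3, 6, 5]) (N 3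
 (I 4 [2, 0, 1, 4, 5, 6, 3]) (R 2 51)))) (A 2 4 (R 4 119) (A 3 4 (A 3 6 (R 8 123) (H 0 2 6 5 4 3))
 (A 3 6 (N 2 (N 3 (I 7 [4, 1, 0, 2, 3, 6, 5]) (R 2 51)) (R 2 51)) (N 2 (R 2 119) (R 32 114))))))
 (A 1 6 (A 4 3 (A 5 2 (R 2 119) (A 5 3 (R 2 123) (R 2 114))) (R 64 116)) (A 2 3 (H 0 1 4 5 6 2)
 (A 2 4 (A 5 3 (A 6 3 (R 4 125) (R 16 116)) (R 4 116)) (A 2 5 (A 3 4 (A 3 6 (R 8 125)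
 (N 1 (N 3 (I 7 [6, 2, 0, 1, 3, 4, 5]) (R 4 101)) (R 4 101))) (A 3 6 (H 0 1 4 5 6 3) (N 1
 (R 4 119) (R 32 116)))) (H 0 1 4 5 6 2)))))))],
 [A 1 2 (A 4 3 (R 16 127) (R 2 55)) (A 1 3 (A 6 2 (A 3 4 (R 16 127) (A 3 6 (R 64 127)
 (N 3 (I 7 [3, 0, 2, 4, 6, 5, 1]) (R 4 85)))) (R 2 107)) (A 1 4 (A 6 3 (A 2 3 (I 6 [3, 0, 1, 4, 5, 6, 2])
 (A 2 6 (R 4 119) (H 0 2 4 5 6 3))) (R 16 118)) (A 1 6 (A 2 3 (A 3 4 (I 8 [6, 1, 0, 2, 3, 4, 5])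
 (A 3 6 (I 6 [2, 0, 1, 6, 5, 4, 3]) (N 3 (I 4 [2, 0, 1, 6, 5, 4, 3]) (R 2 99)))) (A 2 6
 (R 4 119) (A 3 4 (A 3 6 (R 8 123) (N 2 (N 3 (I 7 [6, 1, 0, 2, 3, 4, 5]) (R 2 99)) (R 2 99)))
 (A 3 6 (H 0 2 4 5 6 3) (N 2 (R 2 119) (R 32 114)))))) (A 2 3 (A 3 4 (R 16 124) (A 3 6
 (N 1 (I 5 [5, 1, 0, 2, 3, 6, 4]) (R 4 29)) (N 1 (N 3 (I 3 [5, 1, 0, 3, 2, 4, 6]) (R 32 114))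
 (R 4 29)))) (A 2 6 (A 3 4 (R 16 120) (A 3 6 (R 64 120) (N 1 (R 4 119) (A 3 7 (R 4 85)
 (N 3 (R 4 93) (R 32 114)))))) (A 3 4 (R 16 120) (A 3 6 (H 0 2 4 5 6 3) (N 1 (N 2 (R 2 119)
 (R 32 114)) (A 2 7 (R 2 247) (A 3 7 (R 2 226) (N 2 (R 2 247) (R 32 114)))))))))))),
V,
A 1 2 (A 4 3 (A 6 3 (R 64 127) (R 2 103)) (R 2 55)) (A 1 3 (A 4 2 (A 3 4 (R 16 127) (A 3 6
 (R 64 127) (N 3 (I 7 [3, 0, 2, 4, 6, 5, 1]) (R 4 85)))) (R 2 59)) (A 1 4 (A 2 3 (A 3 4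
 (I 6 [2, 0, 1, 4, 5, 6, 3]) (A 3 6 (I 8 [4, 1, 0, 2, 3, 6, 5]) (N 3 (I 4 [2, 0, 1, 4, 5, 6, 3])
 (R 2 51)))) (A 2 4 (R 4 119) (A 3 4 (A 3 6 (R 8 123) (H 0 2 6 5 4 3)) (A 3 6 (N 2 (N 3
 (I 7 [4, 1, 0, 2, 3, 6, 5]) (R 2 51)) (R 2 51)) (N 2 (R 2 119) (R 32 114)))))) (A 1 6
 (A 4 3 (A 2 3 (I 6 [3, 0, 1, 6, 5, 4, 2]) (A 2 4 (R 4 119) (H 0 2 6 5 4 3))) (R 64 118))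
 (A 2 3 (A 3 4 (N 1 (I 5 [5, 1, 0, 2, 3, 4, 6]) (R 4 77)) (A 3 6 (R 64 124) (N 1 (N 3
 (I 3 [5, 1, 0, 3, 2, 6, 4]) (R 32 114)) (R 4 77)))) (A 2 4 (A 3 4 (R 16 120) (A 3 6 (R 64 120)
 (N 1 (R 4 119) (A 3 7 (R 4 85) (N 3 (R 4 93) (R 32 114)))))) (A 3 4 (A 3 6 (R 64 120)
 (H 0 2 6 5 4 3)) (A 3 6 (R 64 120) (N 1 (N 2 (R 2 119) (R 32 114)) (A 2 7 (R 2 247) (A 3 7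
 (R 2 178) (N 2 (R 2 247) (R 32 114))))))))))))],
 [A 1 2 (A 4 3 (A 5 3 (I 6 [1, 0, 3, 4, 5, 6, 2]) (A 6 3 (R 8 127) (R 4 119))) (A 5 3
 (A 3 6 (I 6 [2, 0, 3, 6, 5, 4, 1]) (N 3 (I 5 [5, 3, 0, 1, 2, 4, 6]) (R 2 71))) (R 2 119)))
 (A 1 3 (A 2 3 (H 0 1 6 5 4 2) (A 2 5 (A 3 4 (I 6 [1, 0, 2, 4, 5, 6, 3]) (A 3 6 (I 8 [4, 2, 0, 1, 3, 6, 5])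
 (N 3 (I 4 [1, 0, 2, 4, 5, 6, 3]) (R 4 53)))) (A 2 6 (A 5 3 (R 64 127) (R 4 116)) (H 0 1 6 5 4 2))))
 (A 1 4 (A 6 3 (A 5 2 (R 2 119) (A 5 3 (R 2 123) (R 2 114))) (R 16 116)) (A 1 5 (A 2 3
 (A 3 4 (I 8 [6, 1, 0, 2, 3, 4, 5]) (A 3 6 (I 6 [2, 0, 1, 6, 5, 4, 3]) (N 3 (I 4 [2, 0, 1, 6, 5, 4, 3])
 (R 2 99)))) (A 2 6 (R 4 119) (A 3 4 (A 3 6 (R 8 123) (N 2 (N 3 (I 7 [6, 1, 0, 2, 3, 4, 5])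
 (R 2 99)) (R 2 99))) (A 3 6 (H 0 2 4 5 6 3) (N 2 (R 2 119) (R 32 114)))))) (A 2 3 (H 0 1 6 5 4 2)
 (A 2 5 (A 3 4 (A 3 6 (R 8 125) (H 0 1 6 5 4 3)) (A 3 6 (N 1 (N 3 (I 7 [4, 2, 0, 1, 3, 6, 5])
 (R 4 53)) (R 4 53)) (N 1 (R 4 119) (R 32 116)))) (A 2 6 (A 5 3 (A 4 3 (R 4 125) (R 64 116))
 (R 4 116)) (H 0 1 6 5 4 2))))))),
A 1 2 (A 4 3 (A 6 3 (R 64 127) (R 4 103)) (R 2 119)) (A 1 3 (A 2 3 (R 4 127) (A 2 4 (A 3 4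
 (I 6 [1, 0, 2, 4, 5, 6, 3]) (A 3 6 (I 8 [4, 2, 0, 1, 3, 6, 5]) (N 3 (I 4 [1, 0, 2, 4, 5, 6, 3])
 (R 4 53)))) (A 2 6 (A 4 3 (I 6 [3, 0, 2, 6, 5, 4, 1]) (R 4 117)) (A 3 4 (N 2 (I 5 [5, 2, 0, 1, 3, 4, 6])
 (R 2 75)) (A 3 6 (R 64 122) (N 2 (N 3 (I 3 [5, 2, 0, 3, 1, 6, 4]) (R 32 116)) (R 2 75)))))))
 (A 1 4 (A 2 3 (A 3 4 (R 16 127) (A 3 6 (R 64 127) (N 3 (I 7 [3, 0, 1, 4, 6, 5, 2]) (R 2 83))))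
 (A 2 4 (R 2 119) (A 2 6 (R 2 119) (A 3 4 (R 16 120) (A 3 6 (R 64 120) (N 2 (R 2 119)
 (A 3 7 (R 2 83) (N 3 (R 2 91) (R 32 116))))))))) (A 2 3 (R 4 61) (A 2 4 (A 3 4 (A 3 6
 (R 8 125) (H 0 1 6 5 4 3)) (A 3 6 (N 1 (N 3 (I 7 [4, 2, 0, 1, 3, 6, 5]) (R 4 53)) (R 4 53))
 (N 1 (R 4 119) (R 32 116)))) (A 2 6 (A 4 3 (H 0 1 6 5 4 3) (R 4 117)) (A 3 4 (A 3 6 (R 64 120)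
 (H 0 1 6 5 4 3)) (A 3 6 (R 64 120) (N 1 (R 4 119) (R 32 116))))))))),
A 4 3 (A 1 2 (A 3 5 (I 8 [4, 3, 0, 1, 2, 6, 5]) (H 0 1 6 5 4 3)) (A 1 3 (A 4 2 (R 4 127)
 (A 5 2 (I 6 [3, 0, 2, 6, 5, 4, 1]) (R 2 123))) (A 1 4 (A 5 2 (R 2 119) (A 5 3 (R 2 123)
 (R 2 114))) (A 1 5 (A 2 3 (I 6 [3, 0, 1, 6, 5, 4, 2]) (A 2 4 (R 4 119) (H 0 2 6 5 4 3)))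
 (A 2 3 (R 4 125) (A 2 4 (A 5 3 (R 4 125) (R 4 116)) (A 2 5 (H 0 1 6 5 4 3) (A 3 5 (N 1
 (N 2 (I 7 [4, 3, 0, 1, 2, 6, 5]) (R 8 57)) (R 8 57)) (H 0 1 6 5 4 3))))))))) (R 64 116)]]

open Cert in
/-- Certificates for the exceptional component C3. -/
def cert1 : List (List Cert) :=
 [[V,
A 1 2 (A 6 3 (N 3 (I 6 [0, 1, 4, 5, 6, 3, 2]) (R 2 23)) (R 2 119)) (A 1 3 (A 2 3 (I 8 [6, 4, 1, 0, 3, 2, 5])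
 (A 2 6 (N 3 (I 8 [3, 0, 2, 5, 6, 4, 1]) (R 4 101)) (A 3 6 (N 2 (I 6 [0, 1, 4, 6, 5, 2, 3])
 (R 2 27)) (N 2 (N 3 (I 4 [0, 1, 4, 6, 5, 2, 3]) (R 16 114)) (R 2 27))))) (A 1 6 (A 2 3
 (N 3 (I 8 [3, 0, 1, 4, 6, 5, 2]) (R 2 83)) (N 2 (R 2 119) (R 16 114))) (A 2 3 (A 3 6
 (N 1 (I 6 [0, 2, 5, 6, 4, 1, 3]) (R 4 45)) (N 1 (N 3 (I 4 [0, 2, 5, 6, 4, 1, 3]) (R 16 114))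
 (R 4 45))) (A 2 6 (N 1 (R 4 119) (R 32 116)) (A 3 6 (N 1 (N 2 (N 3 (I 5 [0, 1, 4, 6, 5, 2, 3])
 (R 16 114)) (R 16 114)) (R 32 116)) (N 1 (N 2 (N 3 (I 3 [0, 1, 4, 6, 5, 2, 3]) (R 16 114))
 (R 16 114)) (R 32 116))))))),
A 1 2 (A 5 3 (N 3 (I 6 [0, 1, 4, 6, 5, 3, 2]) (R 2 23)) (R 2 119)) (A 1 3 (A 2 3 (I 8 [5, 4, 1, 0, 3, 2, 6])
 (A 2 5 (N 3 (I 8 [3, 0, 2, 5, 6, 4, 1]) (R 4 101)) (A 3 5 (N 2 (I 6 [0, 1, 4, 5, 6, 2, 3])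
 (R 2 27)) (N 2 (N 3 (I 4 [0, 1, 4, 5, 6, 2, 3]) (R 16 114)) (R 2 27))))) (A 1 5 (A 2 3
 (N 3 (I 8 [3, 0, 1, 4, 5, 6, 2]) (R 2 51)) (N 2 (R 2 119) (R 16 114))) (A 2 3 (A 3 5
 (N 1 (I 6 [0, 2, 6, 5, 4, 1, 3]) (R 4 77)) (N 1 (N 3 (I 4 [0, 2, 6, 5, 4, 1, 3]) (R 16 114))
 (R 4 77))) (A 2 5 (N 1 (R 4 119) (R 32 116)) (A 3 5 (N 1 (N 2 (N 3 (I 5 [0, 1, 4, 5, 6, 2, 3])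
 (R 16 114)) (R 16 114)) (R 32 120)) (N 1 (N 2 (N 3 (I 3 [0, 1, 4, 5, 6, 2, 3]) (R 16 114))
 (R 16 114)) (R 64 116)))))))]]

open Cert in
/-- Certificates for the exceptional component C7. -/
def cert2 : List (List Cert) :=
 [[V,
A 1 2 (A 9 3 (R 516 2047) (A 10 3 (R 1056 2047) (R 130 2039))) (A 1 3 (A 9 2 (H 0 1 4 10 9 2)
 (A 10 2 (A 3 6 (R 68 2047) (A 3 7 (R 12 2047) (A 3 8 (R 12 2047) (A 3 9 (R 516 2047)
 (N 3 (I 10 [3, 0, 2, 5, 6, 7, 8, 9, 10, 4, 1]) (R 2052 3135)))))) (R 130 2010))) (A 1 6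
 (A 2 3 (A 3 7 (R 130 2047) (A 3 8 (R 10 2047) (A 3 9 (R 10 2047) (A 3 10 (R 1026 2047)
 (N 3 (I 10 [3, 0, 1, 4, 10, 9, 8, 7, 6, 5, 2]) (R 2050 2175)))))) (A 2 7 (R 258 503)
 (A 2 8 (R 272 2036) (A 2 9 (R 576 2036) (A 2 10 (R 514 1655) (A 3 7 (R 130 2010) (A 3 8
 (R 10 2011) (A 3 9 (R 10 2011) (A 3 10 (R 1026 2010) (N 2 (R 2 119) (A 3 11 (R 10 2175)
 (N 3 (R 2 91) (A 11 12 (R 4098 6271) (N 3 (R 4128 4223) (A 11 13 (R 8194 10367) (A 12 13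
 (R 40 12415) (N 11 (R 32 2164) (A 12 14 (R 16386 18551) (A 13 14 (R 16386 18551) (N 11
 (R 16386 18551) (R 16 1074))))))))))))))))))))) (A 1 7 (H 1 4 10 9 8 7) (A 1 8 (H 1 4 5 6 7 8)
 (A 1 9 (A 10 2 (R 66 1655) (A 10 3 (R 1056 2047) (R 2 1554))) (A 1 10 (A 6 3 (H 0 1 4 5 6 3)
 (A 7 3 (A 9 2 (H 0 2 5 6 7 3) (R 130 2010)) (R 516 2039))) (A 2 3 (R 516 2028) (A 2 6
 (A 9 3 (R 516 2028) (A 10 3 (R 1028 2045) (R 130 2039))) (A 2 7 (A 6 3 (R 80 2047) (R 4 228))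
 (A 2 8 (H 2 5 4 10 9 8) (A 2 9 (H 0 1 4 10 9 2) (A 2 10 (A 3 6 (R 68 2028) (A 3 7 (R 12 2029)
 (A 3 8 (R 12 2029) (A 3 9 (R 516 2028) (N 1 (R 4 1079) (A 3 11 (R 12 3135) (N 3 (R 4 1069)
 (A 11 12 (R 4100 7231) (N 3 (R 4112 5183) (A 11 13 (R 8196 11327) (A 12 13 (R 24 13375)
 (N 11 (R 16 3122) (A 12 14 (R 16388 19511) (A 13 14 (R 16388 19511) (N 11 (R 16388 19511)
 (R 32 116)))))))))))))))) (A 3 6 (R 80 2040) (A 3 7 (R 130 2010) (A 3 8 (R 24 2043) (A 3 9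
 (R 516 2028) (A 3 10 (R 1056 2040) (N 1 (R 516 2039) (A 2 11 (R 130 4087) (A 3 11 (R 130 4050)
 (N 2 (R 130 4087) (A 3 12 (R 516 6116) (A 11 12 (R 130 4050) (N 3 (R 130 4059) (A 11 13
 (R 130 4050) (A 12 13 (R 516 6116) (N 3 (N 11 (R 1 2059) (A 12 14 (R 130 4050) (A 13 14
 (R 130 4050) (N 11 (R 130 4050) (A 12 15 (R 16 1074) (A 13 15 (R 16 1074) (A 14 15 (R 2308 57335)
 (N 12 (R 1 4109) (A 13 16 (R 32 116) (A 14 16 (R 16 1074) (A 15 16 (R 16 1074) (N 12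
 (R 516 6116) (A 13 17 (R 32 116) (A 14 17 (R 16 1074) (A 15 17 (R 16 1074) (A 16 17 (R 4226 204791)
 (N 13 (R 1 8205) (R 16 1074)))))))))))))))))) (A 11 14 (R 130 4050) (A 12 14 (R 516 6116)
 (A 13 14 (N 11 (R 2 2067) (A 12 15 (R 16 1074) (A 13 15 (R 8 24585) (A 14 15 (R 8 24585)
 (N 11 (R 130 4050) (R 32 116)))))) (N 11 (R 2 2067) (A 12 15 (R 16 1074) (A 13 15 (R 16 1074)
 (A 14 15 (R 16 1074) (N 11 (R 130 4050) (R 32 116)))))))))))))))))))))))))))))))))))),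
A 5 2 (A 9 3 (A 7 1 (H 1 4 10 9 8 7) (R 516 2028)) (A 10 3 (H 0 2 5 4 10 3) (R 130 2039)))
 (A 5 3 (A 8 3 (H 3 5 4 10 9 8) (A 9 3 (H 3 5 6 7 8 9) (R 80 2036))) (A 9 2 (H 2 6 5 4 10 9)
 (A 9 3 (A 5 1 (A 7 3 (R 144 2040) (A 8 3 (H 0 1 4 10 9 3) (R 1028 2039))) (A 7 1 (R 640 2040)
 (A 7 3 (R 144 2040) (A 8 1 (H 0 1 4 5 6 2) (A 8 3 (A 7 2 (R 1028 2045) (H 0 2 6 7 8 3))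
 (R 1028 2036)))))) (A 10 2 (H 2 6 7 8 9 10) (A 10 3 (A 8 1 (R 80 2036) (R 1088 2040))
 (R 130 2034)))))),
A 5 3 (A 9 3 (H 3 5 6 7 8 9) (R 144 2036)) (A 9 3 (A 5 2 (R 544 2040) (A 6 2 (A 5 1 (R 258 503)
 (H 0 1 4 5 6 2)) (A 6 3 (H 3 6 5 4 10 9) (A 10 2 (R 258 2039) (A 10 3 (R 258 2043) (R 258 2034))))))
 (R 144 2036)),
A 5 3 (A 6 3 (A 9 2 (H 0 2 8 7 6 3) (A 10 2 (R 288 2040) (R 130 2043))) (R 272 2036))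
 (A 6 3 (A 5 2 (H 2 5 4 10 9 8) (A 9 2 (A 7 1 (R 640 2036) (A 7 3 (R 36 1005) (H 0 2 8 7 6 3)))
 (A 9 3 (H 3 6 5 4 10 9) (A 10 2 (R 1088 2040) (A 10 3 (H 0 2 8 9 10 3) (R 130 2034))))))
 (R 272 2036)),
A 5 2 (H 2 5 6 7 8 9) (A 5 3 (A 6 1 (R 36 2047) (A 7 1 (H 1 4 10 9 8 7) (R 520 2028)))
 (A 6 2 (H 2 6 5 4 10 9) (A 6 3 (A 5 1 (A 7 2 (R 144 2036) (A 8 2 (H 0 1 4 10 9 2) (R 1032 2043)))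
 (A 7 1 (R 640 2036) (A 7 2 (R 144 2036) (A 8 1 (H 0 1 4 5 6 3) (A 8 2 (A 7 3 (R 36 1005)
 (H 0 2 8 7 6 3)) (R 1032 2040)))))) (A 10 2 (R 258 2039) (A 10 3 (A 7 3 (R 258 2043)
 (R 528 2036)) (R 258 2034)))))),
A 1 2 (A 5 3 (R 1056 2047) (A 9 3 (R 132 1526) (R 130 2039))) (A 1 3 (A 5 2 (A 3 6 (R 68 2047)
 (A 3 7 (R 12 2047) (A 3 8 (R 12 2047) (A 3 9 (R 516 2047) (N 3 (I 10 [3, 0, 2, 5, 6, 7, 8, 9, 10, 4, 1])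
 (R 2052 3135)))))) (A 6 2 (H 0 1 4 5 6 2) (R 258 1018))) (A 1 5 (A 8 3 (A 6 2 (H 2 6 7 8 9 10)
 (R 258 1018)) (A 9 3 (H 0 1 4 10 9 3) (R 68 2039))) (A 1 6 (A 5 2 (R 514 1655) (A 5 3
 (R 1056 2047) (R 2 114))) (A 1 7 (H 1 4 10 9 8 7) (A 1 8 (H 1 4 5 6 7 8) (A 1 9 (A 2 3
 (A 3 5 (R 34 2047) (A 3 6 (R 10 2047) (A 3 7 (R 10 2047) (A 3 8 (R 258 2047) (N 3 (I 10 [3, 0, 1, 4, 5, 6, 7, 8, 9, 10, 2])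
 (R 2050 3615)))))) (A 2 5 (R 66 1655) (A 2 6 (R 576 2036) (A 2 7 (R 144 2036) (A 2 8
 (R 130 1943) (A 3 5 (R 34 1018) (A 3 6 (R 10 1019) (A 3 7 (R 10 1019) (A 3 8 (R 258 1018)
 (N 2 (R 2 1559) (A 3 11 (R 10 3615) (N 3 (R 2 539) (A 11 12 (R 4098 7711) (N 3 (R 5120 5663)
 (A 11 13 (R 8194 11807) (A 12 13 (R 1032 13855) (N 11 (R 1024 3604) (A 12 14 (R 16386 19991)
 (A 13 14 (R 16386 19991) (N 11 (R 16386 19991) (R 16 1074))))))))))))))))))))) (A 2 3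
 (R 68 2028) (A 2 5 (A 3 6 (R 68 2028) (A 3 7 (R 12 2029) (A 3 8 (R 12 2029) (A 3 9 (R 516 2028)
 (N 1 (R 4 1079) (A 3 11 (R 12 3135) (N 3 (R 4 1069) (A 11 12 (R 4100 7231) (N 3 (R 4112 5183)
 (A 11 13 (R 8196 11327) (A 12 13 (R 24 13375) (N 11 (R 16 3122) (A 12 14 (R 16388 19511)
 (A 13 14 (R 16388 19511) (N 11 (R 16388 19511) (R 32 116)))))))))))))))) (A 2 6 (H 0 1 4 5 6 2)
 (A 2 7 (H 2 7 6 5 4 10) (A 2 8 (A 9 3 (R 528 2047) (R 4 1796)) (A 2 9 (A 5 3 (R 36 2045)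
 (A 6 3 (R 68 2028) (R 258 2039))) (A 3 5 (R 1056 2040) (A 3 6 (R 68 2028) (A 3 7 (R 24 2043)
 (A 3 8 (R 258 1018) (A 3 9 (R 528 2040) (N 1 (R 68 2039) (A 2 11 (R 258 4087) (A 3 11
 (R 258 3058) (N 2 (R 258 4087) (A 3 12 (R 68 6116) (A 11 12 (R 258 3058) (N 3 (R 258 3067)
 (A 11 13 (R 258 3058) (A 12 13 (R 68 6116) (N 3 (N 11 (R 1 2059) (A 12 14 (R 258 3058)
 (A 13 14 (R 258 3058) (N 11 (R 258 3058) (A 12 15 (R 16 1074) (A 13 15 (R 16 1074) (A 14 15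
 (R 2116 57335) (N 12 (R 1 4109) (A 13 16 (R 1024 1556) (A 14 16 (R 16 1074) (A 15 16
 (R 16 1074) (N 12 (R 68 6116) (A 13 17 (R 1024 1556) (A 14 17 (R 16 1074) (A 15 17 (R 16 1074)
 (A 16 17 (R 4226 204791) (N 13 (R 1 8205) (R 16 1074)))))))))))))))))) (A 11 14 (R 258 3058)
 (A 12 14 (R 68 6116) (A 13 14 (N 11 (R 2 2067) (A 12 15 (R 16 1074) (A 13 15 (R 8 24585)
 (A 14 15 (R 8 24585) (N 11 (R 258 3058) (R 1024 1556)))))) (N 11 (R 2 2067) (A 12 15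
 (R 16 1074) (A 13 15 (R 16 1074) (A 14 15 (R 16 1074) (N 11 (R 258 3058) (R 1024 1556))))))))))))))))))))))))))))))))))))]]

open Cert in
/-- Certificates for the exceptional component G71. -/
def cert3 : List (List Cert) :=
 [[],
 [V,
V,
V,
R 20 2036,
V,
A 10 2 (R 68 2036) (A 10 3 (A 7 3 (R 24 2040) (R 514 1015)) (R 32 1136)),
A 9 1 (H 0 1 5 4 10 2) (A 9 3 (A 7 2 (R 20 2036) (R 514 1019)) (R 68 2036))],
 [],
 [V,
R 18 2034,
V,
V,
V,
R 18 2034,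
R 18 2034],
 [],
 [V,
A 10 1 (R 66 2034) (A 10 3 (A 7 3 (R 24 2040) (R 34 1015)) (R 32 1136)),
V,
R 20 2036,
V,
V,
A 5 1 (H 0 1 5 4 10 2) (A 5 3 (A 7 2 (R 20 2036) (R 34 1019)) (R 260 2036))],
 [V,
A 9 2 (H 0 1 10 4 5 2) (A 9 3 (A 7 1 (R 18 2034) (R 516 1021)) (R 66 2034)),
V,
R 20 2036,
V,
A 5 2 (H 0 1 10 4 5 2) (A 5 3 (A 7 1 (R 18 2034) (R 36 1021)) (R 258 2034)),
A 5 3 (A 9 3 (H 0 1 10 4 5 3) (R 1088 2036)) (R 1280 2036)]]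

open Cert in
/-- Certificates for the exceptional component G72. -/
def cert4 : List (List Cert) :=
 [[],
 [],
 [],
 [V,
V,
V,
V,
V,
R 18 2034,
R 18 2034],
 [],
 [V,
V,
V,
R 20 2036,
V,
V,
R 260 2036],
 [V,
V,
V,
R 258 2034,
V,
R 258 2034,
V]]

open Cert in
/-- Certificates for the exceptional component G73. -/
def cert5 : List (List Cert) :=
 [[],
 [V,
V,
V,
V,
V,
A 10 3 (A 1 2 (R 130 2039) (H 0 1 5 4 9 2)) (R 544 2036),
A 9 3 (A 1 2 (R 258 2039) (H 0 1 5 4 10 2)) (R 1056 2036)],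
 [],
 [],
 [],
 [V,
A 10 3 (A 1 2 (R 130 2039) (H 0 1 9 4 5 2)) (R 544 2036),
V,
V,
V,
V,
A 5 3 (A 1 2 (R 66 2039) (H 0 1 9 4 10 2)) (R 1536 2036)],
 [V,
A 9 3 (A 1 2 (R 258 2039) (H 0 1 10 4 5 2)) (R 1056 2036),
V,
V,
V,
A 5 3 (A 1 2 (R 66 2039) (H 0 1 10 4 9 2)) (R 1536 2036),
V]]

open Cert in
/-- Certificates for the exceptional component G74. -/
def cert6 : List (List Cert) :=
 [[],
 [],
 [],
 [],
 [],
 [V,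
V,
V,
V,
V,
V,
V],
 []]

open Cert in
/-- Certificates for the exceptional component G75. -/
def cert7 : List (List Cert) :=
 [[V,
V,
V,
R 66 2034,
R 66 2034,
V,
V],
 [],
 [],
 [R 68 2036,
V,
V,
V,
A 1 2 (R 34 2039) (H 0 1 7 6 8 2),
V,
V],
 [R 68 2036,
V,
V,
A 1 2 (R 34 2039) (H 0 1 8 6 7 2),
V,
V,
V],
 [],
 []]

open Cert in
/-- Certificates for the exceptional component G76. -/
def cert8 : List (List Cert) :=
 [[V,
V,
V,
V,
V,
V,
V],
 [],
 [],
 [],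
 [],
 [],
 []]

open Cert in
/-- Certificates for the exceptional component C11. -/
def cert9 : List (List Cert) :=
 [[V,
A 12 2 (H 2 5 4 14 13 12) (A 12 3 (A 13 1 (R 4128 30847) (A 14 1 (A 7 3 (R 8452 32767)
 (A 8 3 (R 40 509) (R 1056 4080))) (A 6 1 (R 40 28799) (A 6 2 (R 4226 32767) (A 11 1 (R 40 28797)
 (A 11 2 (R 4112 30783) (A 13 2 (R 24 28735) (A 6 3 (R 2080 31796) (A 11 3 (R 24 30747)
 (A 13 3 (H 0 1 4 14 13 3) (A 10 1 (R 40 28797) (R 296 32765)))))))))))) (A 13 2 (R 517 32767)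
 (A 13 3 (A 6 1 (R 40 24703) (A 10 1 (R 8708 32767) (A 11 1 (R 1064 32767) (R 8452 32748))))
 (R 1040 32274)))),
A 8 3 (A 12 2 (R 262 32767) (A 12 3 (H 3 8 9 10 11 12) (A 13 2 (R 8450 32767) (A 13 3
 (A 7 1 (R 2051 32767) (A 7 2 (R 4226 32767) (H 0 2 6 7 8 3))) (R 1040 32304))))) (A 9 3
 (A 7 3 (R 1104 32767) (A 12 3 (R 41 32767) (A 13 3 (H 3 9 10 11 12 13) (R 1044 32758))))
 (A 13 3 (A 8 1 (R 8452 32767) (A 9 1 (R 66 1014) (R 2112 8160))) (R 2128 32756))),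
A 5 3 (A 9 3 (R 1044 32767) (A 13 3 (R 521 32767) (R 2192 32756))) (A 6 3 (A 9 3 (R 8201 32767)
 (A 13 3 (R 4226 32767) (R 2192 32756))) (A 8 3 (A 5 2 (R 272 17407) (A 6 2 (A 12 3 (R 24 28731)
 (A 13 3 (R 4226 32767) (R 1040 32304))) (A 9 2 (R 258 1023) (A 9 3 (R 2178 32767) (A 14 2
 (R 258 1019) (A 14 3 (R 144 16895) (A 5 1 (H 0 1 5 6 7 2) (A 9 1 (R 16640 25080) (A 14 1
 (R 130 16631) (A 13 3 (R 272 17394) (R 2178 32759))))))))))) (A 9 3 (A 13 3 (H 3 9 10 11 12 13)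
 (A 14 3 (R 1044 32767) (R 2178 32246))) (A 13 3 (R 2068 24566) (R 2068 32759))))),
A 5 3 (A 6 3 (A 12 2 (R 20 28727) (A 13 2 (R 4226 32767) (R 1040 32304))) (A 7 3 (R 272 17407)
 (A 14 3 (R 20 16895) (A 7 1 (R 36 511) (A 9 1 (R 288 1023) (A 9 3 (R 20 16887) (A 14 1
 (R 4132 32767) (A 7 2 (H 0 2 7 6 5 3) (A 9 2 (R 20 17399) (A 14 2 (R 528 2034) (A 12 3
 (R 20 16887) (A 13 3 (R 20 16887) (R 1044 32759))))))))))))) (A 6 3 (A 12 2 (H 2 8 9 10 11 12)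
 (A 12 3 (R 266 32767) (A 13 2 (A 7 1 (R 8320 29172) (A 7 3 (R 4226 32767) (H 0 2 8 7 6 3)))
 (A 13 3 (R 8450 32767) (R 1040 32304))))) (A 7 3 (A 9 3 (R 258 1023) (A 5 1 (H 0 1 5 6 7 3)
 (A 9 1 (R 16640 25076) (A 14 1 (R 258 17399) (A 14 3 (R 258 1015) (A 5 2 (R 130 511)
 (A 9 2 (R 2178 32767) (A 14 2 (R 144 16895) (A 13 3 (R 258 1015) (R 2306 32759))))))))))
 (A 9 3 (R 258 503) (A 14 3 (R 258 1014) (A 7 2 (R 258 1015) (A 9 2 (R 258 1015) (A 5 1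
 (R 20 16887) (A 14 1 (R 258 17399) (A 7 1 (R 20 16887) (A 9 1 (R 20 16885) (A 5 2 (R 258 1015)
 (A 14 2 (R 258 1011) (A 13 3 (R 258 1014) (R 2306 32759)))))))))))))),
A 6 3 (A 8 1 (R 16904 32767) (A 10 1 (R 16904 32767) (A 11 1 (H 1 4 14 13 12 11) (R 8260 32748))))
 (A 7 3 (A 5 2 (R 1048 32767) (A 13 2 (H 2 9 10 11 12 13) (A 14 2 (R 1048 32767) (R 2178 32250))))
 (R 528 18420)),
A 12 3 (A 5 2 (R 536 32767) (A 6 2 (H 2 6 7 8 9 10) (A 14 2 (R 536 32767) (R 4354 31738))))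
 (A 13 3 (A 8 1 (H 1 4 5 6 7 8) (A 9 1 (R 1064 32767) (A 11 1 (R 1064 32767) (R 8260 32748))))
 (R 1040 32308)),
A 13 3 (A 6 2 (A 5 1 (R 1064 32767) (H 0 1 4 5 6 2)) (A 6 3 (R 2114 32767) (A 7 2 (R 20 16631)
 (A 7 3 (R 24 24826) (R 528 18416))))) (A 14 3 (A 12 3 (R 2064 31807) (A 5 3 (R 20 30783)
 (A 5 1 (R 16516 32767) (A 10 1 (R 18432 31775) (A 10 3 (R 20 30775) (A 12 1 (R 16388 30751)
 (A 5 2 (R 1040 32274) (A 10 2 (R 20 31799) (A 12 2 (H 0 2 12 13 14 3) (A 9 3 (R 20 30775)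
 (R 148 32759))))))))))) (A 10 3 (R 2050 30743) (A 12 3 (A 5 1 (R 2050 31799) (A 5 3 (R 2050 31767)
 (A 10 1 (R 2080 30836) (A 14 1 (H 0 1 14 13 12 3) (A 5 2 (R 4112 30783) (A 10 2 (R 4354 32767)
 (A 14 2 (R 4098 30751) (A 8 3 (R 2050 31767) (A 9 3 (R 2050 31767) (R 2114 32759))))))))))
 (A 5 3 (R 2050 31766) (A 10 2 (R 2050 31767) (A 12 2 (R 2050 31767) (A 5 1 (R 2050 31799)
 (A 14 1 (R 20 30775) (A 10 1 (R 20 30773) (A 12 1 (R 20 30775) (A 5 2 (R 2050 31763)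
 (A 14 2 (R 2050 31767) (A 8 3 (R 2050 31766) (A 9 3 (R 2050 31766) (R 2114 32759))))))))))))))),
A 5 3 (A 13 1 (R 4128 30847) (A 14 1 (A 7 2 (R 8456 32767) (A 8 2 (R 36 509) (R 1056 4080)))
 (A 6 1 (R 36 28799) (A 6 2 (R 2080 31800) (A 11 1 (R 36 28797) (A 11 2 (R 36 30845) (A 13 2
 (H 0 1 4 14 13 2) (A 6 3 (R 4226 32767) (A 11 3 (R 4112 30783) (A 13 3 (R 20 28735) (A 10 1
 (R 36 28797) (R 292 32765)))))))))))) (A 6 3 (A 10 3 (H 3 6 7 8 9 10) (A 11 3 (R 4226 32767)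
 (A 13 3 (R 4226 32767) (R 276 32694)))) (A 10 3 (A 14 3 (R 532 32767) (R 4354 31734))
 (R 4368 32756))),
A 5 3 (A 6 1 (R 36 24703) (A 10 1 (R 548 32767) (A 11 1 (R 1060 32767) (R 8456 32748))))
 (A 6 3 (A 8 1 (R 8456 32767) (A 8 2 (A 7 1 (R 8320 29172) (A 7 3 (R 4226 32767) (H 0 2 8 7 6 3)))
 (A 9 1 (R 66 1018) (A 9 2 (R 68 1005) (R 2112 8160))))) (A 10 3 (A 7 3 (R 16393 32767)
 (A 11 3 (A 6 2 (R 1030 32767) (A 7 2 (R 6 24823) (R 528 18416))) (R 8720 32756))) (A 11 3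
 (A 6 2 (R 2114 32767) (A 7 2 (R 20 24822) (A 7 3 (R 24 16635) (R 528 18416)))) (R 8450 32758)))),
A 6 2 (R 1029 32767) (A 6 3 (A 8 1 (R 16904 32767) (A 12 1 (R 259 32767) (R 17472 32760)))
 (A 7 2 (H 2 7 6 5 4 14) (A 7 3 (A 5 1 (H 0 1 5 6 7 3) (A 6 1 (R 16512 25087) (A 13 1
 (R 16392 24831) (A 8 1 (R 16392 24829) (A 8 2 (R 144 16895) (A 13 2 (R 4226 32767) (A 8 3
 (R 24 507) (A 13 3 (R 16640 17396) (A 11 1 (R 16392 24829) (A 12 1 (R 16392 24829) (R 16904 32765)))))))))))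
 (R 528 2034))))]]

open Cert in
/-- Certificates for the exceptional component G11. -/
def cert10 : List (List Cert) :=
 [[V,
V,
V,
V,
R 66 28914,
R 66 28914,
R 66 28914,
R 66 28914,
V,
V,
V],
 [],
 [],
 [],
 [R 68 28916,
V,
V,
V,
V,
A 10 1 (A 2 3 (A 3 4 (R 18 18239) (A 3 11 (R 2050 7951) (N 3 (I 11 [3, 0, 1, 10, 12, 6, 5, 4, 14, 13, 7, 11, 8, 9, 2])
 (R 32 16496)))) (A 2 4 (R 18 18199) (A 2 11 (R 4098 16327) (A 3 4 (R 4098 15810) (A 3 11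
 (R 2560 7951) (N 2 (R 2 1799) (R 32 16496))))))) (A 10 3 (R 1312 32760) (A 11 1 (R 2592 32756)
 (A 11 3 (R 2082 32250) (R 68 7781)))),
R 1312 32756,
R 2320 32756,
V,
V,
V],
 [R 68 28916,
V,
V,
V,
A 10 2 (A 1 3 (A 3 4 (R 20 18239) (A 3 11 (R 2052 7951) (N 3 (I 11 [3, 0, 2, 10, 12, 6, 5, 4, 14, 13, 7, 11, 8, 9, 1])
 (R 32 16496)))) (A 1 4 (R 66 29426) (A 1 11 (R 130 16327) (A 3 4 (R 4100 15812) (A 3 11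
 (R 2560 7951) (N 1 (R 4 1799) (R 32 16496))))))) (A 10 3 (R 1312 32760) (A 11 2 (R 2592 32756)
 (A 11 3 (R 2084 32252) (R 66 7779)))),
V,
A 1 2 (A 4 3 (R 4098 15879) (A 8 3 (R 4098 15879) (R 66 999))) (A 1 3 (A 8 2 (A 3 4 (R 20 18239)
 (A 3 11 (R 2052 7951) (N 3 (I 11 [3, 0, 2, 10, 12, 6, 5, 4, 14, 13, 7, 11, 8, 9, 1])
 (R 32 16496)))) (R 66 1003)) (A 1 4 (R 66 29426) (A 1 8 (R 132 10119) (A 1 11 (A 2 3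
 (A 3 4 (R 18 20031) (A 3 8 (R 258 3983) (N 3 (I 11 [3, 0, 1, 9, 7, 6, 5, 4, 14, 13, 12, 8, 11, 10, 2])
 (R 32 16496)))) (A 2 4 (R 18 19991) (A 2 8 (R 130 16327) (A 3 4 (R 130 15298) (A 3 8
 (R 1280 3983) (N 2 (R 2 3591) (R 32 16496))))))) (A 2 3 (R 68 7277) (A 2 4 (R 68 29940)
 (A 2 8 (A 3 4 (R 4100 15812) (A 3 11 (R 2560 7951) (N 1 (R 4 1799) (R 32 16496)))) (A 2 11
 (R 4098 15879) (A 3 4 (R 72 28920) (A 3 8 (R 1312 32760) (A 3 11 (R 2592 32760) (N 1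
 (R 132 16327) (R 32 16496))))))))))))),
R 2592 32756,
V,
V,
V],
 [R 68 28916,
V,
V,
V,
R 1312 32756,
A 1 2 (A 4 3 (R 130 10119) (A 8 3 (R 4100 15879) (R 66 6087))) (A 1 3 (A 11 2 (A 3 4 (R 20 20031)
 (A 3 8 (R 260 3983) (N 3 (I 11 [3, 0, 2, 9, 7, 6, 5, 4, 14, 13, 12, 8, 11, 10, 1]) (R 32 16496))))
 (R 66 7275)) (A 1 4 (R 66 29938) (A 1 8 (A 2 3 (A 3 4 (R 18 18239) (A 3 11 (R 2050 7951)
 (N 3 (I 11 [3, 0, 1, 10, 12, 6, 5, 4, 14, 13, 7, 11, 8, 9, 2]) (R 32 16496)))) (A 2 4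
 (R 18 18199) (A 2 11 (R 4098 16327) (A 3 4 (R 4098 15810) (A 3 11 (R 2560 7951) (N 2
 (R 2 1799) (R 32 16496))))))) (A 1 11 (R 4100 15879) (A 2 3 (R 68 1005) (A 2 4 (R 68 29428)
 (A 2 8 (R 130 10119) (A 2 11 (A 3 4 (R 132 15300) (A 3 8 (R 1280 3983) (N 1 (R 4 3591)
 (R 32 16496)))) (A 3 4 (R 72 28920) (A 3 8 (R 1312 32760) (A 3 11 (R 2592 32760) (N 1
 (R 4100 16327) (R 32 16496))))))))))))),
V,
A 8 2 (R 1312 32756) (A 8 3 (R 292 31740) (A 9 2 (A 1 3 (A 3 4 (R 20 20031) (N 3 (I 11 [3, 0, 2, 9, 7, 6, 5, 4, 14, 13, 12, 8, 11, 10, 1])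
 (R 32 16496))) (A 1 4 (R 2 1043) (A 1 8 (R 4098 16327) (A 3 4 (R 68 7140) (N 1 (R 4 3591)
 (R 32 16496)))))) (A 9 3 (R 2592 32760) (R 66 2019)))),
V,
V,
V],
 [R 68 28916,
V,
V,
V,
R 2320 32756,
R 2592 32756,
A 8 1 (R 1312 32756) (A 8 3 (R 290 31738) (A 9 1 (A 2 3 (A 3 4 (R 18 20031) (N 3 (I 11 [3, 0, 1, 9, 7, 6, 5, 4, 14, 13, 12, 8, 11, 10, 2])
 (R 32 16496))) (A 2 4 (R 2 2563) (A 2 8 (R 130 16327) (A 3 4 (R 66 7138) (N 2 (R 2 3591)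
 (R 32 16496)))))) (A 9 3 (R 2592 32760) (R 68 2021)))),
V,
V,
V,
V],
 [],
 [],
 []]

open Cert in
/-- Certificates for the exceptional component G15. -/
def cert11 : List (List Cert) :=
 [[V,
V,
V,
V,
V,
V,
V,
R 66 458994,
V,
V,
V,
R 66 458994,
V,
V,
V],
 [],
 [],
 [],
 [],
 [],
 [],
 [R 258 48898,
V,
V,
V,
V,
V,
V,
V,
V,
V,
V,
R 258 16131,
V,
V,
V],
 [],
 [],
 [],
 [R 68 458996,
V,
V,
V,
V,
V,
V,
R 260 16133,
V,
V,
V,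
V,
V,
V,
V],
 [],
 [],
 []]

open Cert in
/-- Certificate for the case of maximum degree 2. -/
def certTwo : Cert :=
 N 0 (R 0 1) (N 0 (N 1 (R 0 3) (N 2 (I 0 [0, 1, 2]) (R 4 15))) (A 1 2 (I 1 [0, 1, 2]) (N 1
 (N 2 (I 0 [1, 0, 2]) (R 4 15)) (A 2 3 (R 1 15) (N 2 (R 2 15) (A 3 4 (R 1 31) (N 3 (R 1 15)
 (A 4 5 (H 0 1 3 5 4 2) (N 4 (R 1 23) (A 5 6 (I 2 [0, 1, 3, 5, 6, 4, 2]) (N 5 (R 1 47)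
 (A 6 7 (R 33 255) (N 6 (R 1 87) (A 7 8 (R 129 511) (N 7 (R 2 171) (A 8 9 (R 513 1023)
 (N 8 (R 4 341) (A 9 10 (I 9 [0, 1, 3, 5, 7, 9, 10, 8, 6, 4, 2]) (N 9 (R 8 682) (R 1537 4095))))))))))))))))))))

def allCerts : List (List (List Cert)) :=
  [cert0, cert1, cert2, cert3, cert4, cert5, cert6, cert7, cert8, cert9, cert10, cert11]

theorem ok_two : check 2 15 certTwo ⟨1, 0, 0, 0⟩ = true := by decide +kernel

theorem ok_root : (excs.zip allCerts).all (fun p => rootCheck p.1 p.2) = true := by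
  decide +kernel

/-! ## Part 8: there is no minimal counterexample -/

def expA (T : Nat) : Nat → Nat → Bool
  | a + 4, b + 4 => tb T a b
  | 0, 1 => true
  | 0, 2 => true
  | 0, 3 => true
  | 1, 0 => true
  | 2, 0 => true
  | 3, 0 => true
  | _, _ => false

def expP (T : Nat) : Nat → Nat → Bool
  | a + 4, b + 4 => tb T a b
  | 0, 1 => true
  | 0, 2 => true
  | 0, 3 => true
  | 1, 0 => true
  | 2, 0 => true
  | 3, 0 => true
  | 0, _ => false
  | _, 0 => false
  | a, b => !(Nat.beq a b)

def expZ : Nat → Bool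
  | 1 => false
  | 2 => false
  | 3 => false
  | _ => true

theorem root_tables : excs.all (fun e => allLt (4 + e.1) fun i =>
    (((rootSt e).Z.testBit i).xor (!(expZ i))) && allLt (4 + e.1) fun j =>
    ((tb (rootSt e).A i j).xor (!(expA e.2 i j))) && (((tb (rootSt e).A j i).xor (!(expA e.2 i j))) &&
      ((tb (rootSt e).P i j).xor (!(expP e.2 i j))))) = true := by
  decide +kernel

def rootMap {V : Type u} (v x y z : V) (ψ : Nat → V) : Nat → V
  | 0 => v
  | 1 => x
  | 2 => y
  | 3 => z
  | a + 4 => ψ a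

theorem xor_not {a b : Bool} (h : a.xor (!b) = true) : a = b := by
  revert h; cases a <;> cases b <;> decide

section final
open scoped Classical
variable {V : Type u} [Fintype V] {G : SimpleGraph V}

theorem root_real {e : Nat × Nat} (he : e ∈ excs) {v x y z : V} {C S : Finset V} {ψ : Nat → V}
    (hN : ∀ w, G.Adj v w ↔ (w = x ∨ w = y ∨ w = z)) (hxy : x ≠ y) (hxz : x ≠ z) (hyz : y ≠ z)
    (hS : ∀ w, w ∈ S ↔ (w = v ∨ w = x ∨ w = y ∨ w = z)) (hC : IsComp G S C)
    (hψ : IsCopy G C e.1 e.2 ψ) : Real G (rootMap v x y z ψ) (rootSt e) := by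
  have htab := List.all_eq_true.1 root_tables e he
  simp only [allLt_iff, Bool.and_eq_true] at htab
  have hm := (excs_small e he).1
  have hvx : G.Adj v x := (hN x).2 (by simp)
  have hvy : G.Adj v y := (hN y).2 (by simp)
  have hvz : G.Adj v z := (hN z).2 (by simp)
  have hψS : ∀ a, a < e.1 → ψ a ≠ v ∧ ψ a ≠ x ∧ ψ a ≠ y ∧ ψ a ≠ z := by
    intro a ha
    have := hC.disj _ (hψ.mem a ha)
    rw [hS] at this
    push Not at this
    exact this
  have hvψ : ∀ a, a < e.1 → ¬ G.Adj v (ψ a) := by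
    intro a ha h
    rw [hN] at h
    have := hψS a ha
    tauto
  have hn : (rootSt e).n = 4 + e.1 := rfl
  refine ⟨by rw [hn]; omega, ?_, ?_, ?_, ?_, ?_⟩ <;> rw [hn]
  · intro i hi j hj hij
    have q1 := hvx.ne
    have q2 := hvy.ne
    have q3 := hvz.ne
    rcases i with _ | _ | _ | _ | a <;> rcases j with _ | _ | _ | _ | b <;>
      simp only [rootMap] at hij
    all_goals first
      | rfl
      | exact absurd hij (by assumption)
      | exact absurd hij.symm (by assumption)
      | (exfalso; have := hψS a (by omega); rw [hij] at this; simp at this; done)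
      | (exfalso; have := hψS b (by omega); rw [← hij] at this; simp at this; done)
      | (have := hψ.inj a (by omega) b (by omega) hij; omega)
  · intro i hi j hj hij
    rw [xor_not ((htab i hi).2 j hj).1] at hij
    rcases i with _ | _ | _ | _ | a <;> rcases j with _ | _ | _ | _ | b <;>
      simp only [rootMap, expA, Bool.false_eq_true] at hij ⊢
    all_goals first
      | exact hvx
      | exact hvy
      | exact hvz
      | exact hvx.symm
      | exact hvy.symm
      | exact hvz.symm
      | exact (hψ.adj a (by omega) b (by omega)).2 hij
  · intro i hi j hj hij
    rw [xor_not ((htab i hi).2 j hj).1] at hij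
    rw [xor_not ((htab i hi).2 j hj).2.1]
    exact hij
  · intro i hi j hj hij
    rw [xor_not ((htab i hi).2 j hj).2.2]
    rcases i with _ | _ | _ | _ | a <;> rcases j with _ | _ | _ | _ | b <;>
      simp only [rootMap] at hij
    all_goals first
      | rfl
      | exact absurd hij (G.loopless.irrefl _)
      | exact (hψ.adj a (by omega) b (by omega)).1 hij
      | exact absurd hij (hvψ b (by omega))
      | exact absurd hij.symm (hvψ a (by omega))
      | (simp only [expP, Bool.not_eq_true', ← Bool.not_eq_true, beq_iff]; omega)
  · intro i hi hz w hw
    rw [xor_not (htab i hi).1] at hz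
    have hin : ∀ w, w ∈ S ∨ w ∈ C → ∃ j < 4 + e.1, rootMap v x y z ψ j = w := by
      rintro w (hw | hw)
      · rw [hS] at hw
        rcases hw with rfl | rfl | rfl | rfl
        · exact ⟨0, by omega, rfl⟩
        · exact ⟨1, by omega, rfl⟩
        · exact ⟨2, by omega, rfl⟩
        · exact ⟨3, by omega, rfl⟩
      · obtain ⟨a, ha, rfl⟩ := hψ.surj w hw
        exact ⟨a + 4, by omega, rfl⟩
    apply hin
    rcases i with _ | _ | _ | _ | a
    · left
      rw [hS]
      right
      exact (hN w).1 hw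
    · exact Bool.noConfusion hz
    · exact Bool.noConfusion hz
    · exact Bool.noConfusion hz
    · by_cases hwC : w ∈ C
      · exact Or.inr hwC
      · exact Or.inl (hC.out _ (hψ.mem a (by omega)) w hwC hw)

theorem finAll_n : ∀ (k : Nat) (s : St), (finAll k s).n = s.n := by
  intro k
  induction k with
  | zero => intro s; rfl
  | succ k ih => intro s; rw [finAll, ih, finish_n]

theorem finAll_real {h : Nat} {φ : Nat → V} (hx : Ctx G 3 h) : ∀ (k : Nat) (s : St), k ≤ s.n →
    Real G φ s → Real G φ (finAll k s) := by
  intro k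
  induction k with
  | zero => intro s _ hr; exact hr
  | succ k ih =>
    intro s hk hr
    exact ih _ (by rw [finish_n]; omega) (finish_real hx (by omega) hr)

theorem IsCopy.rotate {C : Finset V} {e : Nat × Nat} {ψ : Nat → V} (hψ : IsCopy G C e.1 e.2 ψ)
    (hrot : rot e = true) (a : Nat) (ha : a < e.1) :
    IsCopy G C e.1 e.2 (fun i => ψ ((i + a) % e.1)) := by
  have hlt : ∀ i, (i + a) % e.1 < e.1 := fun i => Nat.mod_lt _ (by omega)
  refine ⟨fun i _ => hψ.mem _ (hlt i), ?_, ?_, ?_⟩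
  · intro i hi j hj hij
    have h1 := hψ.inj _ (hlt i) _ (hlt j) hij
    have h2 : i ≡ j [MOD e.1] := Nat.ModEq.add_right_cancel' a h1
    rw [Nat.ModEq, Nat.mod_eq_of_lt hi, Nat.mod_eq_of_lt hj] at h2
    exact h2
  · intro c hc
    obtain ⟨k, hk, rfl⟩ := hψ.surj c hc
    refine ⟨(k + (e.1 - a)) % e.1, Nat.mod_lt _ (by omega), ?_⟩
    have : ((k + (e.1 - a)) % e.1 + a) % e.1 = k := by
      rw [Nat.mod_add_mod]
      have : k + (e.1 - a) + a = k + e.1 := by omega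
      rw [this, Nat.add_mod_right, Nat.mod_eq_of_lt hk]
    simp only [this]
  · intro i hi j hj
    simp only [rot, allLt_iff] at hrot
    rw [hψ.adj _ (hlt i) _ (hlt j), xor_not (hrot a ha i hi j hj)]

theorem no_root {h : Nat} (hx : Ctx G 3 h) {e : Nat × Nat} (he : e ∈ excs) (hh : e.1 = h)
    {v x y z : V} {C S : Finset V} {ψ : Nat → V}
    (hN : ∀ w, G.Adj v w ↔ (w = x ∨ w = y ∨ w = z)) (hxy : x ≠ y) (hxz : x ≠ z) (hyz : y ≠ z)
    (hS : ∀ w, w ∈ S ↔ (w = v ∨ w = x ∨ w = y ∨ w = z)) (hC : IsComp G S C)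
    (hψ : IsCopy G C e.1 e.2 ψ) (hxC : ∃ c ∈ C, G.Adj x c) (hyC : ∃ c ∈ C, G.Adj y c) :
    False := by
  have hd : ∃ d, (e, d) ∈ excs.zip allCerts := by
    obtain ⟨i, hi, rfl⟩ := List.getElem_of_mem he
    have hl : (excs.zip allCerts).length = excs.length := by rfl
    have hj : i < allCerts.length := by rw [List.length_zip] at hl; omega
    exact ⟨allCerts[i], by
      rw [List.mem_iff_getElem]
      exact ⟨i, by omega, by simp⟩⟩
  obtain ⟨cs, hcs⟩ := hd
  have hok := List.all_eq_true.1 ok_root _ hcs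
  obtain ⟨c, hc, hxc⟩ := hxC
  obtain ⟨c', hc', hyc⟩ := hyC
  obtain ⟨a, ha, rfl⟩ := hψ.surj c hc
  have key : ∃ (ψ' : Nat → V) (a' : Nat), IsCopy G C e.1 e.2 ψ' ∧
      a' < (bif rot e then 1 else e.1) ∧ a' < e.1 ∧ G.Adj x (ψ' a') := by
    cases hr : rot e with
    | true =>
      refine ⟨_, 0, hψ.rotate hr a ha, by simp, by omega, ?_⟩
      simp only [Nat.zero_add, Nat.mod_eq_of_lt ha]
      exact hxc
    | false => exact ⟨ψ, a, hψ, by simpa using ha, ha, hxc⟩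
  obtain ⟨ψ', a', hψ', ha1, ha2, hxa⟩ := key
  obtain ⟨b, hb, rfl⟩ := hψ'.surj c' hc'
  have hr0 := root_real he hN hxy hxz hyz hS hC hψ'
  have hn0 : (rootSt e).n = 4 + e.1 := rfl
  have hr := finAll_real hx (4 + e.1) _ (le_of_eq hn0.symm) hr0
  have hn1 : (finAll (4 + e.1) (rootSt e)).n = 4 + e.1 := (finAll_n _ _).trans hn0
  simp only [rootCheck, norm_eq, allLt_iff] at hok
  have h1 := hok a' ha1
  obtain ⟨s1, hr1, h2, hn2⟩ := adjStep_sound hx (by omega) (by omega) hr (i := 1) (j := 4 + a')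
    (by rw [Nat.add_comm 4 a']; exact hxa) h1
  rw [allLt_iff] at h2
  obtain ⟨s2, hr2, h3, hn3⟩ := adjStep_sound hx (by omega) (by omega) hr1 (i := 2) (j := 4 + b)
    (by rw [Nat.add_comm 4 b]; exact hyc) (h2 b hb)
  subst hh
  exact check_sound hx _ _ _ hr2 h3

/-- The vertex `v` of degree 3, with `C` an exceptional component of `G - N[v]`. -/
def BigAt (G : SimpleGraph V) (h : Nat) : Prop :=
  ∃ (v : V) (N S C : Finset V), N.card = 3 ∧ (∀ w, w ∈ N ↔ G.Adj v w) ∧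
    (∀ w, w ∈ S ↔ (w = v ∨ w ∈ N)) ∧ IsComp G S C ∧ ExcOn G C ∧ C.card = h

theorem no_min (hm : Min G) : False := by
  by_cases h3 : ∃ (v : V) (N : Finset V), N.card = 3 ∧ ∀ w, w ∈ N ↔ G.Adj v w
  · -- maximum degree 3
    have hex : ∃ h, BigAt G h := by
      obtain ⟨v, N, hN, hNa⟩ := h3
      by_contra hno
      have hvN : v ∉ N := fun h => G.loopless.irrefl _ ((hNa v).1 h)
      refine reduce excFacts hm (insert v N) {v} Finset.univ (by simp) (by simp) ?_ ?_ ?_ ?_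
      · intro a ha hd
        exfalso
        apply hd
        rcases Finset.mem_insert.1 ha with rfl | ha
        · exact Or.inl (by simp)
        · exact Or.inr ⟨v, by simp, (hNa a).1 ha⟩
      · intro a ha hd
        exfalso
        apply hd
        rcases Finset.mem_insert.1 ha with rfl | ha
        · exact Or.inl (by simp)
        · exact Or.inr ⟨v, by simp, (hNa a).1 ha⟩
      · intro C hC he
        exact absurd ⟨C.card, v, N, insert v N, C, hN, hNa, fun w => Finset.mem_insert, hC, he, rfl⟩
          hno
      · rw [Finset.card_insert_of_notMem hvN, hN]
        simp
    obtain ⟨h0, hh0⟩ := hex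
    have hle : ∀ h, BigAt G h → h ≤ 15 := by
      rintro h ⟨v, N, S, C, _, _, _, _, he, rfl⟩
      exact he.card.1
    set h := Nat.findGreatest (BigAt G) 15 with hh
    have hbig : BigAt G h := Nat.findGreatest_spec (hle h0 hh0) hh0
    have hx : Ctx G 3 h := ⟨hm, hm.deg, fun _ v N S C a1 a2 a3 a4 a5 => by
      have hb : BigAt G C.card := ⟨v, N, S, C, a1, a2, a3, a4, a5, rfl⟩
      exact Nat.le_findGreatest (hle _ hb) hb⟩
    obtain ⟨v, N, S, C, hN3, hN, hS, hC, hE, hcard⟩ := hbig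
    obtain ⟨x, hxS, y, hyS, hxy, hxC, hyC⟩ := two_ends excFacts hm ⟨v, (hS v).2 (Or.inl rfl)⟩ hC hE
    have hmem : ∀ x, x ∈ S → (∃ c ∈ C, G.Adj x c) → x ∈ N := by
      rintro x hxS ⟨c, hc, hxc⟩
      rcases (hS x).1 hxS with rfl | h
      · exact absurd ((hS c).2 (Or.inr ((hN c).2 hxc))) (hC.disj c hc)
      · exact h
    have hxN := hmem x hxS hxC
    have hyN := hmem y hyS hyC
    have hc1 : ((N.erase x).erase y).card = 1 := by
      rw [Finset.card_erase_of_mem (Finset.mem_erase.2 ⟨hxy.symm, hyN⟩),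
        Finset.card_erase_of_mem hxN, hN3]
    obtain ⟨z, hz⟩ := Finset.card_eq_one.1 hc1
    have hNe : ∀ w, w ∈ N ↔ (w = x ∨ w = y ∨ w = z) := by
      intro w
      have := Finset.ext_iff.1 hz w
      simp only [Finset.mem_erase, Finset.mem_singleton] at this
      by_cases h1 : w = x
      · subst h1; simp [hxN]
      · by_cases h2 : w = y
        · subst h2; simp [hyN]
        · rw [← this]; simp [h1, h2]
    have hzN := Finset.ext_iff.1 hz z
    simp only [Finset.mem_erase, Finset.mem_singleton] at hzN
    have hz' := hzN.2 trivial
    obtain ⟨e, he, ψ, hψ⟩ := hE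
    refine no_root hx he (by rw [← hψ.card, hcard]) (v := v) (x := x) (y := y) (z := z) ?_ hxy
      (fun h => hz'.2.1 h.symm) (fun h => hz'.1 h.symm) ?_ hC hψ hxC hyC
    · intro w; rw [← hN, hNe]
    · intro w; rw [hS, hNe]
  · -- maximum degree 2
    have hx : Ctx G 2 15 := ⟨hm, fun v s hs => by
      by_contra hc
      have h33 := hm.deg v s hs
      apply h3
      refine ⟨v, s, by omega, fun w => ⟨hs w, fun hw => ?_⟩⟩
      by_contra hws
      have := hm.deg v (insert w s) (by
        intro u hu
        rcases Finset.mem_insert.1 hu with rfl | hu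
        · exact hw
        · exact hs u hu)
      rw [Finset.card_insert_of_notMem hws] at this
      omega, fun h => by omega⟩
    obtain ⟨v, -⟩ := hm.conn.1
    refine check_sound hx certTwo (fun _ => v) ⟨1, 0, 0, 0⟩ ⟨?_, ?_, ?_, ?_, ?_, ?_⟩ ok_two
    · norm_num
    · intro i hi j hj _
      change i < 1 at hi
      change j < 1 at hj
      omega
    · intro i _ j _ h
      simp [tb] at h
    · intro i _ j _ h
      simp [tb] at h
    · intro i _ j _ h
      exact absurd h (G.loopless.irrefl _)
    · intro i _ h
      simp at h

end final

/-! ## Part 9: conclusion -/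

theorem main (n : Nat) : ∀ (V : Type u) [Fintype V] (G : SimpleGraph V), Fintype.card V = n →
    CC G Finset.univ → (∀ v, ∀ s : Finset V, (∀ w ∈ s, G.Adj v w) → s.card ≤ 3) →
    ¬ hasInducedC6 G → ¬ ExcOn G Finset.univ →
    ∃ D : Finset V, 4 * D.card ≤ Fintype.card V ∧ IsolOn G Finset.univ D := by
  classical
  induction n using Nat.strong_induction_on with
  | _ n ih =>
  intro V _ G hcard hconn hdeg hc6 hexc
  by_contra hbad
  refine no_min (G := G) ⟨hconn, hdeg, hc6, hexc, hbad, ?_⟩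
  intro C hCne hCC hCexc
  have hlt : Fintype.card {x // x ∈ C} < n := by
    rw [Fintype.card_coe, ← hcard, ← Finset.card_univ]
    exact Finset.card_lt_card (Finset.ssubset_univ_iff.2 hCne)
  let val : {x // x ∈ C} ↪ V := Function.Embedding.subtype _
  have key := ih _ hlt {x // x ∈ C} (G.comap val) rfl
  suffices hh : CC (G.comap val) Finset.univ ∧
      (∀ v, ∀ s : Finset {x // x ∈ C}, (∀ w ∈ s, (G.comap val).Adj v w) → s.card ≤ 3) ∧
      ¬ hasInducedC6 (G.comap val) ∧ ¬ ExcOn (G.comap val) Finset.univ by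
    obtain ⟨D, hD1, hD2⟩ := key hh.1 hh.2.1 hh.2.2.1 hh.2.2.2
    refine ⟨D.map val, ?_, ?_, ?_⟩
    · intro x hx
      obtain ⟨y, _, rfl⟩ := Finset.mem_map.1 hx
      exact y.2
    · rw [Finset.card_map]
      rwa [Fintype.card_coe] at hD1
    · have hdom : ∀ a (ha : a ∈ C), ¬ Dom G (D.map val) a → ¬ Dom (G.comap val) D ⟨a, ha⟩ := by
        rintro a ha hn (h | ⟨d, hd, hda⟩)
        · exact hn (Or.inl (Finset.mem_map.2 ⟨_, h, rfl⟩))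
        · exact hn (Or.inr ⟨val d, Finset.mem_map.2 ⟨d, hd, rfl⟩, hda⟩)
      intro b hb a ha c hc da db dc hba hbc
      have := hD2 ⟨b, hb⟩ (Finset.mem_univ _) ⟨a, ha⟩ (Finset.mem_univ _) ⟨c, hc⟩
        (Finset.mem_univ _) (hdom a ha da) (hdom b hb db) (hdom c hc dc) hba hbc
      exact congrArg Subtype.val this
  refine ⟨?_, ?_, ?_, ?_⟩
  · obtain ⟨⟨c, hc⟩, hcut⟩ := hCC
    refine ⟨⟨⟨c, hc⟩, Finset.mem_univ _⟩, ?_⟩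
    intro X _ hXne hX
    have h1 := hcut (X.map val) (by
      intro x hx
      obtain ⟨y, _, rfl⟩ := Finset.mem_map.1 hx
      exact y.2) (hXne.map) (by
      intro a ha b hb hab
      obtain ⟨y, hy, rfl⟩ := Finset.mem_map.1 ha
      exact Finset.mem_map.2 ⟨⟨b, hb⟩, hX y hy ⟨b, hb⟩ (Finset.mem_univ _) hab, rfl⟩)
    ext y
    simp only [Finset.mem_univ, iff_true]
    have : val y ∈ X.map val := by rw [h1]; exact y.2
    obtain ⟨y', hy', he⟩ := Finset.mem_map.1 this
    rwa [← val.injective he]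
  · intro v s hs
    rw [← Finset.card_map val]
    apply hdeg (val v)
    intro w hw
    obtain ⟨y, hy, rfl⟩ := Finset.mem_map.1 hw
    exact hs y hy
  · rintro ⟨f, hf, hadj⟩
    exact hc6 ⟨fun i => val (f i), val.injective.comp hf, hadj⟩
  · rintro ⟨e, he, φ, hφ⟩
    refine hCexc ⟨e, he, fun i => val (φ i), fun i _ => (φ i).2, ?_, ?_, hφ.adj⟩
    · intro i hi j hj hij
      exact hφ.inj i hi j hj (val.injective hij)
    · intro c hc
      obtain ⟨i, hi, hic⟩ := hφ.surj ⟨c, hc⟩ (Finset.mem_univ _)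
      exact ⟨i, hi, by rw [hic]; rfl⟩

theorem iso_of_copy {V : Type u} [Fintype V] {G : SimpleGraph V} {m T : Nat} {φ : Nat → V}
    (h : IsCopy G Finset.univ m T φ) (H : SimpleGraph (Fin m))
    (hH : ∀ i j : Fin m, H.Adj i j ↔ tb T i.val j.val = true) : Nonempty (G ≃g H) := by
  have hb : Function.Bijective (fun i : Fin m => φ i.val) := by
    constructor
    · intro i j hij
      exact Fin.ext (h.inj i i.isLt j j.isLt hij)
    · intro v
      obtain ⟨i, hi, rfl⟩ := h.surj v (Finset.mem_univ _)
      exact ⟨⟨i, hi⟩, rfl⟩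
  exact ⟨RelIso.symm ⟨Equiv.ofBijective _ hb, by
    intro i j
    rw [hH]
    exact h.adj i i.isLt j j.isLt⟩⟩

theorem cc_of_connected {V : Type u} [Fintype V] {G : SimpleGraph V} (h : G.Connected) :
    CC G Finset.univ := by
  obtain ⟨v⟩ := h.nonempty
  refine ⟨⟨v, Finset.mem_univ _⟩, ?_⟩
  rintro X - ⟨a, ha⟩ hX
  ext b
  simp only [Finset.mem_univ, iff_true]
  obtain ⟨p⟩ := h.preconnected a b
  induction p with
  | nil => exact ha
  | cons hadj _ ih => exact ih (hX _ ha _ (Finset.mem_univ _) hadj)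

theorem isolating_of {V : Type u} [Fintype V] {G : SimpleGraph V} {D : Finset V}
    (h : IsolOn G Finset.univ D) : IsP3Isolating G (D : Set V) := by
  rintro ⟨f, hf, hadj⟩
  have hd : ∀ i, ¬ Dom G D (f i).val := by
    intro i hdom
    exact (f i).2 hdom
  have h10 := hadj 1 0 (by rw [SimpleGraph.pathGraph_adj]; decide)
  have h12 := hadj 1 2 (by rw [SimpleGraph.pathGraph_adj]; decide)
  have := h (f 1).val (Finset.mem_univ _) (f 0).val (Finset.mem_univ _) (f 2).val
    (Finset.mem_univ _) (hd 0) (hd 1) (hd 2) h10 h12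
  have := hf (Subtype.ext this)
  exact absurd this (by decide)

end P3I


open P3I

/-- Main theorem: if `G` is a connected subcubic `n`-vertex graph with no induced `6`-cycle
that is not a copy of any of the 12 exceptional graphs
`P3, C3, C7, G₇,₁, …, G₇,₆, C₁₁, G₁₁, G₁₅`, then `ι(G, P3) ≤ ⌊n/4⌋`. -/
theorem stmt19 {V : Type*} [Fintype V] (G : SimpleGraph V) [DecidableRel G.Adj]
    (hconn : G.Connected) (hdeg : ∀ v, G.degree v ≤ 3) (hc6 : ¬ hasInducedC6 G)
    (h3 : ¬ Nonempty (G ≃g SimpleGraph.pathGraph 3))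
    (hc3 : ¬ Nonempty (G ≃g SimpleGraph.cycleGraph 3))
    (hc7 : ¬ Nonempty (G ≃g SimpleGraph.cycleGraph 7))
    (h71 : ¬ Nonempty (G ≃g G71graph)) (h72 : ¬ Nonempty (G ≃g G72graph))
    (h73 : ¬ Nonempty (G ≃g G73graph)) (h74 : ¬ Nonempty (G ≃g G74graph))
    (h75 : ¬ Nonempty (G ≃g G75graph)) (h76 : ¬ Nonempty (G ≃g G76graph))
    (hc11 : ¬ Nonempty (G ≃g SimpleGraph.cycleGraph 11))
    (hg11 : ¬ Nonempty (G ≃g G11graph))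
    (hg15 : ¬ Nonempty (G ≃g G15graph)) :
    iotaP3 G ≤ Fintype.card V / 4 := by
  have hexc : ¬ ExcOn G Finset.univ := by
    rintro ⟨e, he, φ, hφ⟩
    simp only [excs, List.mem_cons, List.not_mem_nil, or_false] at he
    rcases he with rfl | rfl | rfl | rfl | rfl | rfl | rfl | rfl | rfl | rfl | rfl | rfl
    · exact h3 (iso_of_copy hφ _ (by simp only [SimpleGraph.pathGraph_adj]; decide))
    · exact hc3 (iso_of_copy hφ _ (by decide))
    · exact hc7 (iso_of_copy hφ _ (by decide))
    · exact h71 (iso_of_copy hφ _ (by simp only [G71graph, SimpleGraph.fromRel_adj]; decide +kernel))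
    · exact h72 (iso_of_copy hφ _ (by simp only [G72graph, SimpleGraph.fromRel_adj]; decide +kernel))
    · exact h73 (iso_of_copy hφ _ (by simp only [G73graph, SimpleGraph.fromRel_adj]; decide +kernel))
    · exact h74 (iso_of_copy hφ _ (by simp only [G74graph, SimpleGraph.fromRel_adj]; decide +kernel))
    · exact h75 (iso_of_copy hφ _ (by simp only [G75graph, SimpleGraph.fromRel_adj]; decide +kernel))
    · exact h76 (iso_of_copy hφ _ (by simp only [G76graph, SimpleGraph.fromRel_adj]; decide +kernel))
    · exact hc11 (iso_of_copy hφ _ (by decide +kernel))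
    · exact hg11 (iso_of_copy hφ _ (by simp only [G11graph, SimpleGraph.fromRel_adj]; decide +kernel))
    · exact hg15 (iso_of_copy hφ _ (by simp only [G15graph, SimpleGraph.fromRel_adj]; decide +kernel))
  obtain ⟨D, hD1, hD2⟩ := P3I.main _ V G rfl (cc_of_connected hconn) (by
    intro v s hs
    refine le_trans (Finset.card_le_card ?_) (hdeg v)
    intro w hw
    rw [SimpleGraph.mem_neighborFinset]
    exact hs w hw) hc6 hexc
  have : iotaP3 G ≤ D.card := Nat.sInf_le ⟨D, rfl, isolating_of hD2⟩
  omega
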